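/- Let L/K satisfy condition (ram) with parameter n ≥ 1, assume G^1 is cyclic and K is unramified over ℚ_p, and let χ be a character of G of conductor p^{n+1}. Write χ = ωψ where ω factors through the unique subgroup Δ of G of order p−1 and ψ has order p^n. For α ∈ O_L put α_ω := Σ_{ρ∈Δ} ω(ρ)·α^ρ. Then for any α in the maximal ideal m_L with v_L(α_ω) < p, there exists β ∈ O_L such that v_π(⟨α|χ⟩) + v_π(⟨β|χ^{-1}⟩) = v_π(Σ_{γ∈G} Tr_{L/K}(α^γ β)·χ(γ)) = n+1. -/

import Mathlib

noncomputable section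

open scoped Classical

/-- An additive `ℚ ∪ {∞}`-valued valuation on a field `A`, normalized by `v p = 1`.
This models the `p`-adic valuation `v_p` on (an algebraic closure of) `ℚ_p`,
with the convention `v 0 = ∞`. -/
structure PadicValData (A : Type) [Field A] (p : ℕ) : Type where
  v : A → WithTop ℚ
  v_top_iff : ∀ x : A, v x = ⊤ ↔ x = 0
  v_mul : ∀ x y : A, v (x * y) = v x + v y
  v_min_le_add : ∀ x y : A, min (v x) (v y) ≤ v (x + y)
  v_coe_p : v (p : A) = 1

variable {p : ℕ} {A : Type} [Field A]

/-- `x ∈ F` is a uniformizer of the `p`-adic field `F` (embedded in `A` by `emb`):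
its valuation is minimal among the positive valuations of elements of `F`. -/
def IsUniformizer (vd : PadicValData A p) {F : Type} [Field F] (emb : F →+* A) (x : F) : Prop :=
  x ≠ 0 ∧ 0 < vd.v (emb x) ∧
    ∀ y : F, 0 < vd.v (emb y) → vd.v (emb x) ≤ vd.v (emb y)

/-- `y` belongs to the `j`-th power `m_F^j` of the maximal ideal of the ring of integers
`O_F` of `F` (embedded in `A` by `emb`): `y` is a multiple, by an element of `O_F`, of a
product of `j` elements of the maximal ideal `m_F`.  (For `j = 0` this says `y ∈ O_F`.) -/
def InMaxIdealPow (vd : PadicValData A p) {F : Type} [Field F] (emb : F →+* A) (j : ℕ)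
    (y : A) : Prop :=
  ∃ (u : F) (s : Fin j → F), 0 ≤ vd.v (emb u) ∧ (∀ k, 0 < vd.v (emb (s k))) ∧
    y = emb u * ∏ k, emb (s k)

/-- The lower-numbering ramification set
`G_i = {σ ∈ Gal(L/K) | ∀ x ∈ O_L, σ x - x ∈ m_L^{i+1}}` (with `G_i = G` for `i ≤ -1`). -/
def lowerRamSet (vd : PadicValData A p) (K L : Type) [Field K] [Field L] [Algebra K L]
    (emb : L →+* A) (i : ℤ) : Set (L ≃ₐ[K] L) :=
  {σ | ∀ x : L, 0 ≤ vd.v (emb x) →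
    InMaxIdealPow vd emb (i + 1).toNat (emb (σ x) - emb x)}

/-- The Herbrand function `φ_{L/K}(u) = ∫_0^u dt / (G_0 : G_t)`, where `G_t = G_{⌈t⌉}`. -/
noncomputable def herbrandPhi (vd : PadicValData A p) (K L : Type) [Field K] [Field L]
    [Algebra K L] (emb : L →+* A) (u : ℝ) : ℝ :=
  ∫ t in (0:ℝ)..u,
    (Nat.card ↥(lowerRamSet vd K L emb ⌈t⌉) : ℝ) /
      (Nat.card ↥(lowerRamSet vd K L emb 0) : ℝ)

/-- The Herbrand function `ψ_{L/K}`, the inverse of `φ_{L/K}`. -/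
noncomputable def herbrandPsi (vd : PadicValData A p) (K L : Type) [Field K] [Field L]
    [Algebra K L] (emb : L →+* A) (w : ℝ) : ℝ :=
  Function.invFun (herbrandPhi vd K L emb) w

/-- The upper-numbering ramification set `G^i = G_{ψ_{L/K}(i)}` of `Gal(L/K)`. -/
def upperRamSet (vd : PadicValData A p) (K L : Type) [Field K] [Field L] [Algebra K L]
    (emb : L →+* A) (i : ℤ) : Set (L ≃ₐ[K] L) :=
  lowerRamSet vd K L emb ⌈herbrandPsi vd K L emb (i : ℝ)⌉

/-- Condition (ram): the upper ramification groups of `L/K` satisfy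
`G = G^{-1} = G^0 ⊇ G^1 ⊋ G^2 ⊋ ⋯ ⊋ G^n ⊋ G^{n+1} = {1}`, with `G^i/G^{i+1}` of order `p`
for `1 ≤ i ≤ n` and `G^0/G^1` of order `p - 1`. -/
def RamCond (vd : PadicValData A p) (K L : Type) [Field K] [Field L] [Algebra K L]
    (emb : L →+* A) (n : ℕ) : Prop :=
  upperRamSet vd K L emb (-1) = Set.univ ∧
  upperRamSet vd K L emb 0 = Set.univ ∧
  (∀ i : ℤ, upperRamSet vd K L emb (i + 1) ⊆ upperRamSet vd K L emb i) ∧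
  Nat.card ↥(upperRamSet vd K L emb 0)
    = (p - 1) * Nat.card ↥(upperRamSet vd K L emb 1) ∧
  (∀ i : ℕ, 1 ≤ i → i ≤ n →
    Nat.card ↥(upperRamSet vd K L emb (i : ℤ))
      = p * Nat.card ↥(upperRamSet vd K L emb ((i : ℤ) + 1))) ∧
  upperRamSet vd K L emb ((n : ℤ) + 1) = {1}

/-- The local resolvent `⟨α|χ⟩ = ∑_{γ ∈ Gal(L/K)} χ(γ) γ(α)`, computed in `A`. -/
noncomputable def localResolvent (K L : Type) [Field K] [Field L] [Algebra K L]
    (emb : L →+* A) (χ : (L ≃ₐ[K] L) → A) (α : L) : A :=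
  ∑ᶠ γ : L ≃ₐ[K] L, χ γ * emb (γ α)

end

namespace S6

section api
variable {F Γ : Type*} [Field F] [AddCommGroup Γ] [LinearOrder Γ] [IsOrderedAddMonoid Γ]
  (w : AddValuation F (WithTop Γ))

lemma ge_mul {x y : F} {r s : Γ} (hx : (r : WithTop Γ) ≤ w x) (hy : (s : WithTop Γ) ≤ w y) :
    ((r + s : Γ) : WithTop Γ) ≤ w (x * y) := by
  rw [w.map_mul, WithTop.coe_add]; exact add_le_add hx hy

lemma ge_pow {x : F} {r : Γ} (hx : (r : WithTop Γ) ≤ w x) (n : ℕ) :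
    ((n • r : Γ) : WithTop Γ) ≤ w (x ^ n) := by
  induction n with
  | zero => simp
  | succ n ih => rw [pow_succ, succ_nsmul]; exact ge_mul w ih hx

lemma ge_nat (n : ℕ) : (0 : WithTop Γ) ≤ w (n : F) := by
  induction n with
  | zero => simp
  | succ n ih => rw [Nat.cast_succ]; exact w.map_le_add ih (by simp)

lemma ge_nat_mul (n : ℕ) {x : F} {r : WithTop Γ} (hx : r ≤ w x) : r ≤ w ((n : F) * x) := by
  rw [w.map_mul]; calc r ≤ w x := hx
    _ = 0 + w x := by simp
    _ ≤ _ := by gcongr; exact ge_nat w n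

lemma ge_mono {x : F} {r s : Γ} (hx : (s : WithTop Γ) ≤ w x) (h : r ≤ s) :
    (r : WithTop Γ) ≤ w x := le_trans (WithTop.coe_le_coe.2 h) hx

lemma eq_mul {x y : F} {r s : Γ} (hx : w x = (r : WithTop Γ)) (hy : w y = (s : WithTop Γ)) :
    w (x * y) = ((r + s : Γ) : WithTop Γ) := by
  rw [w.map_mul, WithTop.coe_add, hx, hy]

lemma eq_pow {x : F} {r : Γ} (hx : w x = (r : WithTop Γ)) (n : ℕ) :
    w (x ^ n) = ((n • r : Γ) : WithTop Γ) := by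
  induction n with
  | zero => simp
  | succ n ih => rw [pow_succ, succ_nsmul]; exact eq_mul w ih hx

lemma ne_zero_of_eq {x : F} {r : Γ} (hx : w x = (r : WithTop Γ)) : x ≠ 0 := by
  rintro rfl; simp at hx

lemma exists_eq {x : F} (hx : x ≠ 0) : ∃ r : Γ, w x = (r : WithTop Γ) := by
  obtain ⟨r, hr⟩ := WithTop.ne_top_iff_exists.1 ((w.ne_top_iff).2 hx)
  exact ⟨r, hr.symm⟩

lemma eq_inv {x : F} {r : Γ} (hx : w x = (r : WithTop Γ)) :
    w x⁻¹ = ((-r : Γ) : WithTop Γ) := by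
  have h0 := ne_zero_of_eq w hx
  obtain ⟨s, hs⟩ := exists_eq w (inv_ne_zero h0)
  have := eq_mul w hx hs
  rw [mul_inv_cancel₀ h0, w.map_one, ← WithTop.coe_zero, WithTop.coe_inj] at this
  rw [hs, eq_neg_of_add_eq_zero_right this.symm]

lemma eq_div {x y : F} {r s : Γ} (hx : w x = (r : WithTop Γ)) (hy : w y = (s : WithTop Γ)) :
    w (x / y) = ((r - s : Γ) : WithTop Γ) := by
  rw [div_eq_mul_inv, sub_eq_add_neg]; exact eq_mul w hx (eq_inv w hy)

lemma ge_div {x y : F} {r s : Γ} (hx : (r : WithTop Γ) ≤ w x) (hy : w y = (s : WithTop Γ)) :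
    ((r - s : Γ) : WithTop Γ) ≤ w (x / y) := by
  rw [div_eq_mul_inv, sub_eq_add_neg]; exact ge_mul w hx (eq_inv w hy).ge

lemma eq_add_left {x y : F} {r s : Γ} (hx : w x = (r : WithTop Γ)) (hy : (s : WithTop Γ) ≤ w y)
    (h : r < s) : w (x + y) = (r : WithTop Γ) := by
  rw [w.map_add_eq_of_lt_left, hx]
  rw [hx]; exact lt_of_lt_of_le (WithTop.coe_lt_coe.2 h) hy

lemma eq_of_sub {x y : F} {r s : Γ} (hx : w x = (r : WithTop Γ))
    (hy : (s : WithTop Γ) ≤ w (y - x))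
    (h : r < s) : w y = (r : WithTop Γ) := by
  have := eq_add_left w hx hy h
  rwa [add_sub_cancel] at this

/-- finite sums with a strictly dominating term -/
lemma eq_sum_dom {ι : Type*} (s : Finset ι) (f : ι → F) (i : ι) (hi : i ∈ s) {r : Γ}
    (h : w (f i) = (r : WithTop Γ)) (hj : ∀ j ∈ s, j ≠ i → (r : WithTop Γ) < w (f j)) :
    w (∑ j ∈ s, f j) = (r : WithTop Γ) := by
  classical
  rw [← Finset.add_sum_erase s f hi, w.map_add_eq_of_lt_left, h]
  rw [h]
  exact w.map_lt_sum (by simp) (fun j hj' => hj j (Finset.mem_of_mem_erase hj')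
    (Finset.ne_of_mem_erase hj'))

/-- finite sums with distinct valuations -/
lemma sum_distinct {ι : Type*} (s : Finset ι) (f : ι → F)
    (hd : ∀ i ∈ s, ∀ j ∈ s, i ≠ j → f i ≠ 0 → f j ≠ 0 → w (f i) ≠ w (f j))
    (hne : ∃ i ∈ s, f i ≠ 0) :
    ∃ i ∈ s, f i ≠ 0 ∧ w (∑ j ∈ s, f j) = w (f i) ∧
      (∀ j ∈ s, w (f i) ≤ w (f j)) ∧ (∀ j ∈ s, j ≠ i → w (f i) < w (f j)) := by
  classical
  obtain ⟨i0, hi0, hi0'⟩ := hne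
  obtain ⟨i, hi, hmin⟩ := Finset.exists_min_image s (fun j => w (f j)) ⟨i0, hi0⟩
  have hfi : f i ≠ 0 := by
    intro h
    have := hmin i0 hi0
    simp only [h, w.map_zero, top_le_iff] at this
    exact hi0' ((w.top_iff).1 this)
  have hlt : ∀ j ∈ s, j ≠ i → w (f i) < w (f j) := by
    intro j hj hji
    by_cases h0 : f j = 0
    · rw [h0, w.map_zero]; exact lt_top_iff_ne_top.2 ((w.ne_top_iff).2 hfi)
    · exact lt_of_le_of_ne (hmin j hj) (hd i hi j hj hji.symm hfi h0)
  obtain ⟨r, hr⟩ := exists_eq w hfi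
  refine ⟨i, hi, hfi, ?_, hmin, hlt⟩
  rw [hr] at hlt ⊢
  exact eq_sum_dom w s f i hi hr hlt

lemma ge_prod {ι : Type*} (s : Finset ι) (f : ι → F) {r : ι → Γ}
    (h : ∀ i ∈ s, (r i : WithTop Γ) ≤ w (f i)) :
    ((∑ i ∈ s, r i : Γ) : WithTop Γ) ≤ w (∏ i ∈ s, f i) := by
  classical
  induction s using Finset.induction_on with
  | empty => simp
  | insert a s ha ih =>
    rw [Finset.sum_insert ha, Finset.prod_insert ha]
    exact ge_mul w (h a (by simp)) (ih fun i hi => h i (by simp [hi]))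

lemma eq_prod {ι : Type*} (s : Finset ι) (f : ι → F) {r : ι → Γ}
    (h : ∀ i ∈ s, w (f i) = (r i : WithTop Γ)) :
    w (∏ i ∈ s, f i) = ((∑ i ∈ s, r i : Γ) : WithTop Γ) := by
  classical
  induction s using Finset.induction_on with
  | empty => simp
  | insert a s ha ih =>
    rw [Finset.sum_insert ha, Finset.prod_insert ha]
    exact eq_mul w (h a (by simp)) (ih fun i hi => h i (by simp [hi]))

lemma le_of_ge_of_eq {x : F} {r s : Γ} (h1 : (r : WithTop Γ) ≤ w x) (h2 : w x = (s : WithTop Γ)) :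
    r ≤ s := by rw [h2] at h1; exact WithTop.coe_le_coe.1 h1

lemma eq_unique {x : F} {r s : Γ} (h1 : w x = (r : WithTop Γ)) (h2 : w x = (s : WithTop Γ)) :
    r = s := WithTop.coe_inj.1 (h1 ▸ h2)

end api

lemma ge_of_gt {F : Type*} [Field F] (w : AddValuation F (WithTop ℤ)) {x : F} {r : ℤ}
    (h : (r : WithTop ℤ) < w x) : ((r + 1 : ℤ) : WithTop ℤ) ≤ w x := by
  by_cases h0 : x = 0
  · simp [h0]
  · obtain ⟨s, hs⟩ := exists_eq w h0
    rw [hs] at h ⊢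
    have := WithTop.coe_lt_coe.1 h
    exact WithTop.coe_le_coe.2 (by omega)

end S6

namespace S6

structure Core (p : ℕ) (K L : Type) [Field K] [Field L] [Algebra K L]
    (w : AddValuation L (WithTop ℤ)) (ϖ : L) (e : ℕ) : Prop where
  prime : p.Prime
  inv : ∀ (σ : L ≃ₐ[K] L) (x : L), w (σ x) = w x
  unif : w ϖ = ((1 : ℤ) : WithTop ℤ)
  valK : ∀ k : K, k ≠ 0 → ∃ m : ℤ, w (algebraMap K L k) = ((e * m : ℤ) : WithTop ℤ)
  valp : w (p : L) = ((e : ℤ) : WithTop ℤ)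
  res : ∀ x : L, ((0 : ℤ) : WithTop ℤ) ≤ w x →
    ∃ k : K, ((1 : ℤ) : WithTop ℤ) ≤ w (x - algebraMap K L k)
  epos : 0 < e

namespace Core

variable {p : ℕ} {K L : Type} [Field K] [Field L] [Algebra K L]
    {w : AddValuation L (WithTop ℤ)} {ϖ : L} {e : ℕ}

lemma unif_ne (C : Core p K L w ϖ e) : ϖ ≠ 0 := ne_zero_of_eq w C.unif

lemma val_pow (C : Core p K L w ϖ e) (i : ℕ) : w (ϖ ^ i) = ((i : ℤ) : WithTop ℤ) := by
  have := eq_pow w C.unif i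
  simpa using this

lemma approx (C : Core p K L w ϖ e) {y : L} {m : ℤ} (hy : w y = (m : WithTop ℤ)) :
    ∃ k : K, ∃ i : ℕ, i < e ∧ (i : ℤ) = m % e ∧
      ((m + 1 : ℤ) : WithTop ℤ) ≤ w (y - algebraMap K L k * ϖ ^ i) := by
  have he := C.epos
  set i : ℕ := (m % e).toNat with hi
  have hi0 : 0 ≤ m % e := Int.emod_nonneg _ (by omega)
  have hi1 : m % e < e := Int.emod_lt_of_pos _ (by omega)
  have hiz : (i : ℤ) = m % e := by omega
  have hpow : w ((p : L) ^ (m / e)) = ((e * (m / e) : ℤ) : WithTop ℤ) := by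
    rcases Int.le_total 0 (m / e) with h | h
    · obtain ⟨t, ht⟩ := Int.eq_ofNat_of_zero_le h
      rw [ht, zpow_natCast, eq_pow w C.valp t]
      simp [mul_comm]
    · obtain ⟨t, ht⟩ := Int.eq_ofNat_of_zero_le (Int.neg_nonneg_of_nonpos h)
      have : m / e = -(t : ℤ) := by omega
      rw [this, zpow_neg, zpow_natCast, eq_inv w (eq_pow w C.valp t)]
      simp [mul_comm]
  have hd := eq_mul w hpow (C.val_pow i)
  have hme : (e : ℤ) * (m / e) + i = m := by rw [hiz]; exact Int.mul_ediv_add_emod m e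
  rw [hme] at hd
  have hq := eq_div w hy hd
  rw [sub_self] at hq
  obtain ⟨k, hk⟩ := C.res _ hq.ge
  refine ⟨k * (p : K) ^ (m / e), i, by omega, hiz, ?_⟩
  have h2 := ge_mul w hk hd.ge
  rw [add_comm] at h2
  convert h2 using 2
  have hd0 := ne_zero_of_eq w hd
  rw [sub_mul, div_mul_cancel₀ _ hd0]
  simp only [map_mul, map_zpow₀, map_natCast]; ring

lemma approx_unit (C : Core p K L w ϖ e) {y : L} {m : ℕ}
    (hy : w y = ((m : ℤ) : WithTop ℤ)) :
    ∃ k : K, w (algebraMap K L k) = ((0 : ℤ) : WithTop ℤ) ∧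
      ((m + 1 : ℤ) : WithTop ℤ) ≤ w (y - algebraMap K L k * ϖ ^ m) := by
  have hq := eq_div w hy (C.val_pow m)
  rw [sub_self] at hq
  obtain ⟨k, hk⟩ := C.res _ hq.ge
  refine ⟨k, ?_, ?_⟩
  · rw [w.map_sub_swap] at hk
    exact eq_of_sub w hq hk (by norm_num)
  · have h2 := ge_mul w hk (C.val_pow m).ge
    rw [add_comm] at h2
    convert h2 using 2
    rw [sub_mul, div_mul_cancel₀ _ (pow_ne_zero _ C.unif_ne)]

lemma ge_trace [FiniteDimensional K L] [IsGalois K L] (C : Core p K L w ϖ e) (y : L) :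
    w y ≤ w (algebraMap K L (Algebra.trace K L y)) := by
  rw [trace_eq_sum_automorphisms]
  exact w.map_le_sum fun σ _ => (C.inv σ y).ge

lemma span_top [FiniteDimensional K L] [IsGalois K L] (C : Core p K L w ϖ e) :
    Submodule.span K (Set.range fun i : Fin e => ϖ ^ (i : ℕ)) = ⊤ := by
  set V := Submodule.span K (Set.range fun i : Fin e => ϖ ^ (i : ℕ)) with hV
  have happ : ∀ (x : L) (r : ℤ), (r : WithTop ℤ) ≤ w x → ∀ N : ℕ,
      ∃ v ∈ V, ((r + N : ℤ) : WithTop ℤ) ≤ w (x - v) := by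
    intro x r hr N
    induction N with
    | zero => exact ⟨0, V.zero_mem, by simpa using hr⟩
    | succ N ih =>
      obtain ⟨v, hv, h⟩ := ih
      by_cases h0 : x - v = 0
      · exact ⟨v, hv, by simp [h0]⟩
      obtain ⟨m, hm⟩ := exists_eq w h0
      obtain ⟨k, i, hi, -, hk⟩ := C.approx hm
      refine ⟨v + k • ϖ ^ i, V.add_mem hv (V.smul_mem _ (Submodule.subset_span ⟨⟨i, hi⟩, rfl⟩)), ?_⟩
      have := le_of_ge_of_eq w h hm
      rw [Algebra.smul_def, ← sub_sub]
      exact ge_mono w hk (by push_cast; omega)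
  by_contra hne
  obtain ⟨f, hf0, hf⟩ := Submodule.exists_le_ker_of_lt_top V (lt_top_iff_ne_top.2 hne)
  apply hf0
  have hnd := traceForm_nondegenerate K L
  obtain ⟨z, hz⟩ := ((Algebra.traceForm K L).toDual hnd).surjective f
  have hz' : ∀ x, f x = Algebra.trace K L (z * x) := by
    intro x; rw [← hz, LinearMap.BilinForm.toDual_def, Algebra.traceForm_apply]
  ext x
  by_contra hx
  have hx0 : x ≠ 0 := by rintro rfl; simp at hx
  have hz0 : z ≠ 0 := by rintro rfl; simp [hz'] at hx
  have hfx : algebraMap K L (f x) ≠ 0 := by simpa using hx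
  obtain ⟨M, hM⟩ := exists_eq w hfx
  obtain ⟨r, hr⟩ := exists_eq w hx0
  obtain ⟨s, hs⟩ := exists_eq w hz0
  obtain ⟨v, hv, h⟩ := happ x r hr.ge (M - r - s + 1).toNat
  have hfv : f v = 0 := hf hv
  have h1 : f x = Algebra.trace K L (z * (x - v)) := by rw [← hz', map_sub, hfv, sub_zero]
  have h2 := (ge_mul w hs.ge h).trans (C.ge_trace _)
  rw [← h1, hM] at h2
  have := WithTop.coe_le_coe.1 h2
  omega

lemma term_val (C : Core p K L w ϖ e) {k : K} (hk : k ≠ 0) (i : ℕ) :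
    ∃ m : ℤ, w (algebraMap K L k * ϖ ^ i) = ((e * m + i : ℤ) : WithTop ℤ) := by
  obtain ⟨m, hm⟩ := C.valK k hk
  exact ⟨m, eq_mul w hm (C.val_pow i)⟩

lemma term_distinct (C : Core p K L w ϖ e) (a : ℕ → K) :
    ∀ i ∈ Finset.range e, ∀ j ∈ Finset.range e, i ≠ j →
      algebraMap K L (a i) * ϖ ^ i ≠ 0 → algebraMap K L (a j) * ϖ ^ j ≠ 0 →
      w (algebraMap K L (a i) * ϖ ^ i) ≠ w (algebraMap K L (a j) * ϖ ^ j) := by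
  intro i hi j hj hij h1 h2 h
  have ha : a i ≠ 0 := by rintro h; simp [h] at h1
  have hb : a j ≠ 0 := by rintro h; simp [h] at h2
  obtain ⟨m, hm⟩ := C.term_val ha i
  obtain ⟨m', hm'⟩ := C.term_val hb j
  rw [hm, hm'] at h
  have h3 := WithTop.coe_inj.1 h
  simp only [Finset.mem_range] at hi hj
  have h4 := congrArg (· % (e : ℤ)) h3
  simp only [Int.mul_add_emod_self_left] at h4
  rw [Int.emod_eq_of_lt (by omega) (by omega), Int.emod_eq_of_lt (by omega) (by omega)] at h4
  omega

lemma finrank_eq [FiniteDimensional K L] [IsGalois K L] (C : Core p K L w ϖ e) :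
    Module.finrank K L = e := by
  have hli : LinearIndependent K (fun i : Fin e => ϖ ^ (i : ℕ)) := by
    rw [Fintype.linearIndependent_iff]
    intro g hg i
    by_contra hi
    set a : ℕ → K := fun j => if h : j < e then g ⟨j, h⟩ else 0 with ha
    have hsum : ∑ j ∈ Finset.range e, algebraMap K L (a j) * ϖ ^ j = 0 := by
      rw [← hg, Finset.sum_range]
      refine Finset.sum_congr rfl fun j _ => ?_
      simp [ha, Algebra.smul_def]
    obtain ⟨i', hi', h1, h2, -⟩ := sum_distinct w _ _ (C.term_distinct a)
      ⟨i, by simp, by simp [ha, hi, C.unif_ne]⟩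
    rw [hsum, w.map_zero] at h2
    exact h1 ((w.top_iff).1 h2.symm)
  have B := Module.Basis.mk hli C.span_top.ge
  rw [Module.finrank_eq_card_basis B, Fintype.card_fin]

lemma expand [FiniteDimensional K L] [IsGalois K L] (C : Core p K L w ϖ e) (y : L) :
    ∃ a : ℕ → K, y = ∑ i ∈ Finset.range e, algebraMap K L (a i) * ϖ ^ i := by
  have : y ∈ Submodule.span K (Set.range fun i : Fin e => ϖ ^ (i : ℕ)) := by
    rw [C.span_top]; trivial
  obtain ⟨g, hg⟩ := (Submodule.mem_span_range_iff_exists_fun K).1 this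
  refine ⟨fun j => if h : j < e then g ⟨j, h⟩ else 0, ?_⟩
  rw [← hg, Finset.sum_range]
  refine Finset.sum_congr rfl fun j _ => ?_
  simp [Algebra.smul_def]

lemma card_aut [FiniteDimensional K L] [IsGalois K L] (C : Core p K L w ϖ e) :
    Nat.card (L ≃ₐ[K] L) = e := by
  rw [IsGalois.card_aut_eq_finrank, C.finrank_eq]

lemma eq_of_fix [FiniteDimensional K L] [IsGalois K L] (C : Core p K L w ϖ e)
    {σ : L ≃ₐ[K] L} (h : σ ϖ = ϖ) : σ = 1 := by
  ext y
  obtain ⟨a, rfl⟩ := C.expand y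
  simp [h]

lemma val_one_add_pow {x : L} {c : ℤ} (hc : 0 ≤ c) (hx : (c : WithTop ℤ) ≤ w x) (i : ℕ) :
    (c : WithTop ℤ) ≤ w ((1 + x) ^ i - 1) ∧
    ((2 * c : ℤ) : WithTop ℤ) ≤ w ((1 + x) ^ i - 1 - i * x) := by
  have h1x : ((0 : ℤ) : WithTop ℤ) ≤ w (1 + x) :=
    w.map_le_add (by simp) (ge_mono w hx hc)
  have h2 : ∀ i : ℕ, ((2 * c : ℤ) : WithTop ℤ) ≤ w ((1 + x) ^ i - 1 - i * x) := by
    intro i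
    induction i with
    | zero => simp
    | succ i ih =>
      have : (1 + x) ^ (i + 1) - 1 - ((i + 1 : ℕ) : L) * x
          = ((1 + x) ^ i - 1 - i * x) * (1 + x) + (i : L) * (x * x) := by
        push_cast; ring
      rw [this]
      refine w.map_le_add ?_ (ge_nat_mul w i ?_)
      · have := ge_mul w ih h1x; rwa [add_zero] at this
      · have := ge_mul w hx hx; rwa [← two_mul] at this
  refine ⟨?_, h2 i⟩
  have : (1 + x) ^ i - 1 = ((1 + x) ^ i - 1 - i * x) + i * x := by ring
  rw [this]
  exact w.map_le_add (ge_mono w (h2 i) (by omega)) (ge_nat_mul w i hx)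

lemma sigma_pow (C : Core p K L w ϖ e) (σ : L ≃ₐ[K] L) (k : K) (i : ℕ) :
    σ (algebraMap K L k * ϖ ^ i) - algebraMap K L k * ϖ ^ i
      = algebraMap K L k * ϖ ^ i * ((1 + (σ ϖ - ϖ) / ϖ) ^ i - 1) := by
  have : 1 + (σ ϖ - ϖ) / ϖ = σ ϖ / ϖ := by field_simp [C.unif_ne]; ring
  rw [this, div_pow]
  have := C.unif_ne
  simp only [map_mul, AlgEquiv.commutes, map_pow]
  field_simp

/-- `c(σ) ≥ c` implies that `σ - 1` raises valuations by at least `c`. -/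
lemma ge_sub [FiniteDimensional K L] [IsGalois K L] (C : Core p K L w ϖ e)
    {σ : L ≃ₐ[K] L} {c : ℤ} (hc : 0 ≤ c)
    (hσ : ((1 + c : ℤ) : WithTop ℤ) ≤ w (σ ϖ - ϖ)) {y : L} {r : ℤ}
    (hy : (r : WithTop ℤ) ≤ w y) : ((r + c : ℤ) : WithTop ℤ) ≤ w (σ y - y) := by
  by_cases hy0 : y = 0
  · simp [hy0]
  obtain ⟨a, ha⟩ := C.expand y
  have hne : ∃ i ∈ Finset.range e, algebraMap K L (a i) * ϖ ^ i ≠ 0 := by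
    by_contra h
    push Not at h
    exact hy0 (by rw [ha, Finset.sum_eq_zero h])
  obtain ⟨i, hi, -, h2, h3, -⟩ := sum_distinct w _ _ (C.term_distinct a) hne
  rw [← ha] at h2
  have hx := ge_div w hσ C.unif
  rw [add_sub_cancel_left] at hx
  have : σ y - y = ∑ i ∈ Finset.range e, (σ (algebraMap K L (a i) * ϖ ^ i)
      - algebraMap K L (a i) * ϖ ^ i) := by
    rw [Finset.sum_sub_distrib, ← map_sum, ← ha]
  rw [this]
  refine w.map_le_sum fun j hj => ?_
  rw [C.sigma_pow]
  exact ge_mul w (hy.trans (h2 ▸ h3 j hj)) (val_one_add_pow hc hx j).1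

lemma val_coprime (C : Core p K L w ϖ e) {i : ℕ} (hi : ¬ p ∣ i) :
    w (i : L) = ((0 : ℤ) : WithTop ℤ) := by
  have hcop : Nat.Coprime i p := ((Nat.Prime.coprime_iff_not_dvd C.prime).2 hi).symm
  have hi0 : (i : L) ≠ 0 := by
    intro h0
    obtain ⟨a, b, hab⟩ : IsCoprime (i : ℤ) (p : ℤ) := Nat.isCoprime_iff_coprime.2 hcop
    have := congrArg (Int.cast : ℤ → L) hab
    push_cast at this
    rw [h0, mul_zero, zero_add] at this
    have h1 := w.map_mul (b : L) (p : L)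
    rw [this, w.map_one, C.valp] at h1
    have hb : (0 : WithTop ℤ) ≤ w (b : L) := by
      obtain ⟨b', rfl | rfl⟩ := b.eq_nat_or_neg <;> simp [w.map_neg, ge_nat]
    have h2 : ((e : ℤ) : WithTop ℤ) ≤ 0 := by
      rw [h1]; simpa using add_le_add_left hb ((e : ℤ) : WithTop ℤ)
    have := C.epos
    have h3 : (e : ℤ) ≤ 0 := by exact_mod_cast h2
    omega
  obtain ⟨m, hm⟩ := exists_eq w hi0
  have h0 := ge_nat w i
  rw [hm] at h0
  have h0' : 0 ≤ m := by exact_mod_cast h0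
  rcases h0'.eq_or_lt with h | h
  · rw [hm, h]
  exfalso
  obtain ⟨a, b, hab⟩ : IsCoprime (i : ℤ) (p : ℤ) := Nat.isCoprime_iff_coprime.2 hcop
  have hcast := congrArg (Int.cast : ℤ → L) hab
  push_cast at hcast
  have hint : ∀ b : ℤ, ((0 : ℤ) : WithTop ℤ) ≤ w (b : L) := by
    intro b
    obtain ⟨b', rfl | rfl⟩ := b.eq_nat_or_neg <;> simp [w.map_neg, ge_nat]
  have h1 := ge_mul w (hint a) hm.ge
  have h2 := ge_mul w (hint b) C.valp.ge
  have h3 : ((1 : ℤ) : WithTop ℤ) ≤ w (1 : L) := by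
    rw [← hcast]
    have := C.epos
    exact w.map_le_add (ge_mono w h1 (by omega)) (ge_mono w h2 (by omega))
  rw [w.map_one] at h3
  have : (1 : ℤ) ≤ 0 := by exact_mod_cast h3
  omega

lemma eq_sub [FiniteDimensional K L] [IsGalois K L] (C : Core p K L w ϖ e) (hpe : p ∣ e)
    {σ : L ≃ₐ[K] L} {c : ℤ} (hc : 0 < c)
    (hσ : w (σ ϖ - ϖ) = ((1 + c : ℤ) : WithTop ℤ)) {y : L} {r : ℤ}
    (hy : w y = (r : WithTop ℤ)) (hr : ¬ (p : ℤ) ∣ r) :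
    w (σ y - y) = ((r + c : ℤ) : WithTop ℤ) := by
  have hy0 := ne_zero_of_eq w hy
  obtain ⟨a, ha⟩ := C.expand y
  have hne : ∃ i ∈ Finset.range e, algebraMap K L (a i) * ϖ ^ i ≠ 0 := by
    by_contra h
    push Not at h
    exact hy0 (by rw [ha, Finset.sum_eq_zero h])
  obtain ⟨i, hi, hi0, h2, h3, h4⟩ := sum_distinct w _ _ (C.term_distinct a) hne
  rw [← ha] at h2
  have hx := eq_div w hσ C.unif
  rw [add_sub_cancel_left] at hx
  have : σ y - y = ∑ i ∈ Finset.range e, (σ (algebraMap K L (a i) * ϖ ^ i)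
      - algebraMap K L (a i) * ϖ ^ i) := by
    rw [Finset.sum_sub_distrib, ← map_sum, ← ha]
  rw [this]
  refine eq_sum_dom w _ _ i hi ?_ ?_
  · rw [C.sigma_pow]
    refine eq_mul w (h2 ▸ hy) ?_
    have hpi : ¬ p ∣ i := by
      intro hd
      have hai : a i ≠ 0 := by rintro h; simp [h] at hi0
      obtain ⟨m, hm⟩ := C.term_val hai i
      rw [← h2, hy] at hm
      rw [WithTop.coe_inj.1 hm] at hr
      exact hr (dvd_add (Dvd.dvd.mul_right (by exact_mod_cast hpe) _) (by exact_mod_cast hd))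
    have h5 := eq_mul w (C.val_coprime hpi) hx
    rw [zero_add] at h5
    exact eq_of_sub w h5 (val_one_add_pow hc.le hx.ge i).2 (by omega)
  · intro j hj hji
    rw [C.sigma_pow]
    have h5 := h4 j hj hji
    rw [← h2, hy] at h5
    have h6 := ge_mul w (ge_of_gt w h5) (val_one_add_pow hc.le hx.ge j).1
    exact lt_of_lt_of_le (WithTop.coe_lt_coe.2 (by omega)) h6

end Core
end S6

set_option linter.unusedSectionVars false

namespace S6
namespace Core

variable {p : ℕ} {K L : Type} [Field K] [Field L] [Algebra K L]
    {w : AddValuation L (WithTop ℤ)} {ϖ : L} {e : ℕ}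

/-- iterated difference operator -/
def Z (σ : L ≃ₐ[K] L) (j : ℕ) (y : L) : L := (fun x => σ x - x)^[j] y

lemma Z_zero (σ : L ≃ₐ[K] L) (y : L) : Z σ 0 y = y := rfl

lemma Z_succ (σ : L ≃ₐ[K] L) (j : ℕ) (y : L) : Z σ (j + 1) y = σ (Z σ j y) - Z σ j y := by
  unfold Z; rw [Function.iterate_succ_apply']

lemma pow_expand (σ : L ≃ₐ[K] L) (m : ℕ) (y : L) :
    (σ ^ m) y = ∑ j ∈ Finset.range (m + 1), (m.choose j : L) * Z σ j y := by
  set T : Module.End K L := (σ.toLinearMap : L →ₗ[K] L) - 1 with hT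
  have hZ : ∀ j, Z σ j y = (T ^ j) y := by
    intro j
    induction j with
    | zero => rfl
    | succ j ih => rw [Z_succ, ih, pow_succ', Module.End.mul_apply]; rfl
  have hpow : ∀ m : ℕ, (σ ^ m) y = ((T + 1) ^ m : Module.End K L) y := by
    intro m
    induction m with
    | zero => rfl
    | succ m ih =>
      rw [pow_succ', pow_succ', Module.End.mul_apply, ← ih, hT, sub_add_cancel]; rfl
  rw [hpow, (Commute.one_right T).add_pow, LinearMap.sum_apply]
  refine Finset.sum_congr rfl fun j _ => ?_
  rw [hZ, one_pow, mul_one, ← nsmul_eq_mul', LinearMap.smul_apply, nsmul_eq_mul]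

variable [FiniteDimensional K L] [IsGalois K L]

lemma ge_Z (C : Core p K L w ϖ e) {σ : L ≃ₐ[K] L} {c : ℤ} (hc : 0 ≤ c)
    (hσ : ((1 + c : ℤ) : WithTop ℤ) ≤ w (σ ϖ - ϖ)) {y : L} {r : ℤ}
    (hy : (r : WithTop ℤ) ≤ w y) (j : ℕ) : ((r + j * c : ℤ) : WithTop ℤ) ≤ w (Z σ j y) := by
  induction j with
  | zero => simpa [Z_zero] using hy
  | succ j ih =>
    rw [Z_succ]
    have := C.ge_sub hc hσ ih
    exact ge_mono w this (by push_cast; linarith)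

lemma c_mul (C : Core p K L w ϖ e) {σ τ : L ≃ₐ[K] L} {c : WithTop ℤ}
    (hσ : c ≤ w (σ ϖ - ϖ)) (hτ : c ≤ w (τ ϖ - ϖ)) : c ≤ w ((σ * τ) ϖ - ϖ) := by
  have : (σ * τ) ϖ - ϖ = σ (τ ϖ - ϖ) + (σ ϖ - ϖ) := by
    rw [map_sub, AlgEquiv.mul_apply]; ring
  rw [this]
  exact w.map_le_add (by rwa [C.inv]) hσ

lemma c_inv (C : Core p K L w ϖ e) {σ : L ≃ₐ[K] L} {c : WithTop ℤ}
    (hσ : c ≤ w (σ ϖ - ϖ)) : c ≤ w (σ⁻¹ ϖ - ϖ) := by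
  have : σ⁻¹ ϖ - ϖ = - σ⁻¹ (σ ϖ - ϖ) := by
    rw [map_sub, ← AlgEquiv.mul_apply, inv_mul_cancel]; simp
  rw [this, w.map_neg, C.inv]; exact hσ

lemma c_pow (C : Core p K L w ϖ e) {σ : L ≃ₐ[K] L} {c : WithTop ℤ}
    (hσ : c ≤ w (σ ϖ - ϖ)) (m : ℕ) : c ≤ w ((σ ^ m) ϖ - ϖ) := by
  induction m with
  | zero => simp
  | succ m ih => rw [pow_succ]; exact C.c_mul ih hσ

lemma exists_c (C : Core p K L w ϖ e) {σ : L ≃ₐ[K] L} (h : σ ≠ 1) :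
    ∃ c : ℤ, 0 ≤ c ∧ w (σ ϖ - ϖ) = ((1 + c : ℤ) : WithTop ℤ) := by
  have h0 : σ ϖ - ϖ ≠ 0 := fun h' => h (C.eq_of_fix (sub_eq_zero.1 h'))
  obtain ⟨m, hm⟩ := exists_eq w h0
  have h1 : ((1 : ℤ) : WithTop ℤ) ≤ w (σ ϖ - ϖ) :=
    w.map_le_sub (by rw [C.inv, C.unif]) (by rw [C.unif])
  have := le_of_ge_of_eq w h1 hm
  exact ⟨m - 1, by omega, by rw [hm]; congr 1; ring⟩

lemma tame (C : Core p K L w ϖ e) {σ : L ≃ₐ[K] L}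
    (hσ : ((2 : ℤ) : WithTop ℤ) ≤ w (σ ϖ - ϖ)) {m : ℕ} (hm : ¬ p ∣ m) (h1 : σ ^ m = 1) :
    σ = 1 := by
  by_contra hne
  obtain ⟨c, hc0, hc⟩ := C.exists_c hne
  have hc1 := le_of_ge_of_eq w hσ hc
  have hm0 : m ≠ 0 := by rintro rfl; simp at hm
  have hexp := pow_expand σ m ϖ
  rw [h1, AlgEquiv.one_apply, Finset.sum_range_succ', Nat.choose_zero_right, Nat.cast_one,
    one_mul, Z_zero] at hexp
  have hsum : ∑ k ∈ Finset.range m, (m.choose (k + 1) : L) * Z σ (k + 1) ϖ = 0 := by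
    linear_combination -hexp
  have hval := eq_sum_dom w (Finset.range m)
    (fun k => (m.choose (k + 1) : L) * Z σ (k + 1) ϖ) 0 (by simp; omega) (r := 1 + c) ?_ ?_
  · rw [hsum, w.map_zero] at hval
    exact WithTop.top_ne_coe hval
  · have := eq_mul w (C.val_coprime hm) hc
    simpa [Z_succ, Z_zero] using this
  · intro j _ hj
    have := ge_nat_mul w (m.choose (j + 1)) (C.ge_Z hc0 hc.ge C.unif.ge (j + 1))
    refine lt_of_lt_of_le (WithTop.coe_lt_coe.2 ?_) this
    have : (2 : ℤ) ≤ (j + 1 : ℕ) := by omega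
    nlinarith

lemma val_choose (C : Core p K L w ϖ e) {j : ℕ} (h0 : j ≠ 0) (h1 : j < p) :
    ((e : ℤ) : WithTop ℤ) ≤ w (p.choose j : L) := by
  obtain ⟨t, ht⟩ := C.prime.dvd_choose_self h0 h1
  rw [ht, Nat.cast_mul, mul_comm]
  exact ge_nat_mul w t C.valp.ge

lemma boundA (C : Core p K L w ϖ e) {σ : L ≃ₐ[K] L} {c : ℤ} (hc0 : 0 < c)
    (hc : w (σ ϖ - ϖ) = ((1 + c : ℤ) : WithTop ℤ)) (h1 : σ ^ p = 1) :
    p * c ≤ e + c := by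
  by_contra hlt
  push Not at hlt
  have hexp := pow_expand σ p ϖ
  rw [h1, AlgEquiv.one_apply, Finset.sum_range_succ', Nat.choose_zero_right, Nat.cast_one,
    one_mul, Z_zero] at hexp
  have hsum : ∑ k ∈ Finset.range p, (p.choose (k + 1) : L) * Z σ (k + 1) ϖ = 0 := by
    linear_combination -hexp
  have hpp := C.prime.two_le
  have hval := eq_sum_dom w (Finset.range p)
    (fun k => (p.choose (k + 1) : L) * Z σ (k + 1) ϖ) 0 (by simp; omega)
    (r := e + (1 + c)) ?_ ?_
  · rw [hsum, w.map_zero] at hval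
    exact WithTop.top_ne_coe hval
  · have := eq_mul w C.valp hc
    simpa [Z_succ, Z_zero] using this
  · intro j hj hj0
    have hj' := Finset.mem_range.1 hj
    have hz := C.ge_Z hc0.le hc.ge C.unif.ge (j + 1)
    rcases (by omega : j + 1 = p ∨ j + 1 < p) with h | h
    · simp only [h, Nat.choose_self, Nat.cast_one, one_mul]
      rw [h] at hz
      exact lt_of_lt_of_le (WithTop.coe_lt_coe.2 (by omega)) hz
    · have := ge_mul w (C.val_choose (Nat.succ_ne_zero j) h) hz
      refine lt_of_lt_of_le (WithTop.coe_lt_coe.2 ?_) this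
      have : (2 : ℤ) ≤ (j + 1 : ℕ) := by omega
      nlinarith

lemma boundB (C : Core p K L w ϖ e) {σ : L ≃ₐ[K] L} {c M : ℤ} (hc0 : 0 ≤ c)
    (hc : ((1 + c : ℤ) : WithTop ℤ) ≤ w (σ ϖ - ϖ)) (hM1 : M ≤ p * c) (hM2 : M ≤ e + c) :
    ((1 + M : ℤ) : WithTop ℤ) ≤ w ((σ ^ p) ϖ - ϖ) := by
  have hexp := pow_expand σ p ϖ
  rw [Finset.sum_range_succ', Nat.choose_zero_right, Nat.cast_one,
    one_mul, Z_zero] at hexp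
  rw [hexp, add_sub_cancel_right]
  refine w.map_le_sum fun j hj => ?_
  have hj' := Finset.mem_range.1 hj
  have hz := C.ge_Z hc0 hc C.unif.ge (j + 1)
  rcases (by omega : j + 1 = p ∨ j + 1 < p) with h | h
  · simp only [h, Nat.choose_self, Nat.cast_one, one_mul]
    rw [h] at hz
    exact ge_mono w hz (by omega)
  · have := ge_mul w (C.val_choose (Nat.succ_ne_zero j) h) hz
    refine ge_mono w this ?_
    have : (1 : ℤ) ≤ (j + 1 : ℕ) := by omega
    nlinarith

/-- the last lower break is not a power of `p` -/
lemma not_pow (C : Core p K L w ϖ e) (hab : ∀ σ τ : L ≃ₐ[K] L, σ * τ = τ * σ)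
    {ρ h : L ≃ₐ[K] L} (hρ : w (ρ ϖ - ϖ) = ((1 : ℤ) : WithTop ℤ)) {n : ℕ}
    (hh : w (h ϖ - ϖ) = ((1 + (p ^ n : ℕ) : ℤ) : WithTop ℤ)) : False := by
  set b : ℕ := p ^ n with hb
  have hϖ := C.unif_ne
  set x : L := (h ϖ - ϖ) / ϖ with hx
  set u : L := ρ ϖ / ϖ with hu
  have hbpos : 0 < b := pow_pos C.prime.pos n
  have hwx : w x = ((b : ℤ) : WithTop ℤ) := by
    have := eq_div w hh C.unif
    rwa [add_sub_cancel_left] at this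
  have hwu : w u = ((0 : ℤ) : WithTop ℤ) := by
    have := eq_div w ((C.inv ρ ϖ).trans C.unif) C.unif
    rwa [sub_self] at this
  have hwu1 : w (u - 1) = ((0 : ℤ) : WithTop ℤ) := by
    have := eq_div w hρ C.unif
    rw [sub_self] at this
    rwa [show u - 1 = (ρ ϖ - ϖ) / ϖ by rw [hu]; field_simp]
  -- h u - u small
  obtain ⟨k, hk⟩ := C.res u hwu.ge
  have hhu : ((b + 1 : ℤ) : WithTop ℤ) ≤ w (h u - u) := by
    have := C.ge_sub (by positivity) hh.ge hk
    rw [map_sub h, AlgEquiv.commutes, sub_sub_sub_cancel_right, add_comm] at this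
    exact this
  have hhϖ : h ϖ = ϖ * (1 + x) := by rw [hx]; field_simp; ring
  have hρϖ : ρ ϖ = ϖ * u := by rw [hu]; field_simp
  have hcomm : ρ (h ϖ) = h (ρ ϖ) := by
    rw [← AlgEquiv.mul_apply, hab, AlgEquiv.mul_apply]
  have hkey : u * (ρ x - x) = (h u - u) * (1 + x) := by
    rw [hhϖ, hρϖ, map_mul, map_mul, hρϖ, hhϖ, map_add, map_one] at hcomm
    have : ϖ * (u * (1 + ρ x)) = ϖ * ((1 + x) * h u) := by linear_combination hcomm
    have := mul_left_cancel₀ hϖ this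
    linear_combination this
  have hw1x : ((0 : ℤ) : WithTop ℤ) ≤ w (1 + x) :=
    w.map_le_add (by simp) (ge_mono w hwx.ge (by positivity))
  have hρx : ((b + 1 : ℤ) : WithTop ℤ) ≤ w (ρ x - x) := by
    have h1 := ge_mul w hhu hw1x
    rw [← hkey, w.map_mul, hwu, add_zero] at h1
    simpa using h1
  obtain ⟨k', hk'0, hk'⟩ := C.approx_unit hwx
  have h2 : ((b + 1 : ℤ) : WithTop ℤ) ≤ w (algebraMap K L k' * ϖ ^ b * (u ^ b - 1)) := by
    have e1 : algebraMap K L k' * ϖ ^ b * (u ^ b - 1)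
        = (ρ x - x) - (ρ (x - algebraMap K L k' * ϖ ^ b) - (x - algebraMap K L k' * ϖ ^ b)) := by
      rw [map_sub, map_mul, AlgEquiv.commutes, map_pow, hρϖ]; ring
    rw [e1]
    exact w.map_le_sub hρx (w.map_le_sub (by rwa [C.inv]) hk')
  have h3 : ((1 : ℤ) : WithTop ℤ) ≤ w (u ^ b - 1) := by
    have hd := eq_mul w hk'0 (C.val_pow b)
    have := ge_div w h2 hd
    rw [mul_div_cancel_left₀ _ (ne_zero_of_eq w hd)] at this
    exact ge_mono w this (by omega)
  obtain ⟨r, hr⟩ := exists_add_pow_prime_pow_eq C.prime (⟨u - 1, hwu1.ge⟩ : w.toValuation.integer) 1 n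
  have hr' := congrArg (Subtype.val) hr
  simp only [Subring.coe_add, Subring.coe_pow, Subring.coe_one, Subring.coe_mul, sub_add_cancel,
    one_pow] at hr'
  have hr0 : ((0 : ℤ) : WithTop ℤ) ≤ w (((u - 1) * 1 * r.1 : L)) := by
    have := ge_mul w hwu1.ge (show ((0 : ℤ) : WithTop ℤ) ≤ w r.1 from r.2)
    simpa using this
  have h4 : ((1 : ℤ) : WithTop ℤ) ≤ w ((u - 1) ^ b) := by
    have e2 : (u - 1) ^ b = (u ^ b - 1) - (p : L) * ((u - 1) * 1 * r.1) := by
      rw [hr']; simp; ring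
    rw [e2]
    have := C.epos
    exact w.map_le_sub h3 (ge_mono w (ge_mul w C.valp.ge hr0) (by omega))
  have h5 := eq_pow w hwu1 b
  have := le_of_ge_of_eq w h4 h5
  simp at this

end Core
end S6

set_option linter.unusedSectionVars false

namespace S6

structure Gal (p n : ℕ) (K L : Type) [Field K] [Field L] [Algebra K L]
    (w : AddValuation L (WithTop ℤ)) (ϖ : L) (e : ℕ) (g : L ≃ₐ[K] L)
    (Δ : Subgroup (L ≃ₐ[K] L)) : Prop where
  core : Core p K L w ϖ e
  p3 : 3 ≤ p
  n1 : 1 ≤ n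
  he : e = (p - 1) * p ^ n
  hab : ∀ σ τ : L ≃ₐ[K] L, σ * τ = τ * σ
  hg : orderOf g = p ^ n
  hgw : ((p : ℤ) : WithTop ℤ) ≤ w (g ϖ - ϖ)
  hΔ : Nat.card ↥Δ = p - 1

namespace Gal

variable {p n : ℕ} {K L : Type} [Field K] [Field L] [Algebra K L]
    {w : AddValuation L (WithTop ℤ)} {ϖ : L} {e : ℕ} {g : L ≃ₐ[K] L}
    {Δ : Subgroup (L ≃ₐ[K] L)} [FiniteDimensional K L] [IsGalois K L]

lemma pe (S : Gal p n K L w ϖ e g Δ) : p ∣ e := by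
  rw [S.he]; exact Dvd.dvd.mul_left (dvd_pow_self p (by have := S.n1; omega)) _

lemma not_dvd (S : Gal p n K L w ϖ e g Δ) : ¬ p ∣ p - 1 := by
  have := S.p3
  intro h; have := Nat.le_of_dvd (by omega) h; omega

lemma tameΔ (S : Gal p n K L w ϖ e g Δ) {ρ : L ≃ₐ[K] L} (h : ρ ∈ Δ) (h1 : ρ ≠ 1) :
    w (ρ ϖ - ϖ) = ((1 : ℤ) : WithTop ℤ) := by
  obtain ⟨c, hc0, hc⟩ := S.core.exists_c h1
  rcases eq_or_lt_of_le hc0 with h0 | h0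
  · rw [hc, ← h0]; simp
  · exfalso
    apply h1
    refine S.core.tame (m := p - 1) ?_ S.not_dvd ?_
    · rw [hc]; exact WithTop.coe_le_coe.2 (by omega)
    · have := pow_card_eq_one' (x := (⟨ρ, h⟩ : Δ))
      rw [S.hΔ] at this
      exact congrArg Subtype.val this

lemma exists_tame (S : Gal p n K L w ϖ e g Δ) : ∃ ρ : L ≃ₐ[K] L, 
    w (ρ ϖ - ϖ) = ((1 : ℤ) : WithTop ℤ) := by
  have : 1 < Nat.card Δ := by rw [S.hΔ]; have := S.p3; omega
  have : Nontrivial Δ := (Finite.one_lt_card_iff_nontrivial).1 this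
  obtain ⟨x, hx⟩ := exists_ne (1 : Δ)
  exact ⟨x, S.tameΔ x.2 (fun h => hx (Subtype.ext h))⟩

lemma gpow_ne (S : Gal p n K L w ϖ e g Δ) {k : ℕ} (h0 : 0 < k) (h1 : k < p ^ n) : g ^ k ≠ 1 := by
  intro h
  have := Nat.le_of_dvd h0 (orderOf_dvd_of_pow_eq_one h)
  rw [S.hg] at this; omega

lemma breaks (S : Gal p n K L w ϖ e g Δ) (j : ℕ) : ∀ i, i + j + 1 = n → ∀ c : ℤ, 
    w ((g ^ (p ^ i)) ϖ - ϖ) = ((1 + c : ℤ) : WithTop ℤ) → c < ((p ^ (i + 1) : ℕ) : ℤ) := by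
  have hp3 := S.p3
  induction j with
  | zero =>
    intro i hi c hc
    obtain rfl : i + 1 = n := by omega
    by_contra hlt
    push Not at hlt
    have hpos : 0 < p ^ (i + 1) := Nat.pow_pos (by omega)
    have hA := S.core.boundA (by omega) hc (by rw [← pow_mul, ← pow_succ, ← S.hg, pow_orderOf_eq_one])
    have hle : c ≤ ((p ^ (i + 1) : ℕ) : ℤ) := by
      rw [S.he] at hA
      have h1 : ((p - 1 : ℕ) : ℤ) = p - 1 := by push_cast [show 1 ≤ p by omega]; ring
      rw [Nat.cast_mul, h1] at hA
      have hp : (0 : ℤ) < p - 1 := by omega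
      refine le_of_mul_le_mul_left (a := (p - 1 : ℤ)) ?_ hp
      linarith
    obtain rfl : c = ((p ^ (i + 1) : ℕ) : ℤ) := le_antisymm hle hlt
    obtain ⟨ρ, hρ⟩ := S.exists_tame
    exact S.core.not_pow S.hab hρ hc
  | succ j ih =>
    intro i hi c hc
    by_contra hlt
    push Not at hlt
    have hpos : 0 < p ^ (i + 1) := Nat.pow_pos (by omega)
    have hne : g ^ (p ^ (i + 1)) ≠ 1 := S.gpow_ne hpos (Nat.pow_lt_pow_right (by omega) (by omega))
    obtain ⟨c', -, hc'⟩ := S.core.exists_c hne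
    have h1 := ih (i + 1) (by omega) c' hc'
    have h2 := S.core.boundB (σ := g ^ p ^ i) (c := ((p ^ (i + 1) : ℕ) : ℤ))
      (M := p * ((p ^ (i + 1) : ℕ) : ℤ)) (by omega)
      (by rw [hc]; exact WithTop.coe_le_coe.2 (by omega)) le_rfl (by
        rw [S.he]
        have h1 : ((p - 1 : ℕ) : ℤ) = p - 1 := by push_cast [show 1 ≤ p by omega]; ring
        have h3 : p ^ (i + 1) ≤ p ^ n := Nat.pow_le_pow_right (by omega) (by omega)
        have h3' : ((p ^ (i + 1) : ℕ) : ℤ) ≤ ((p ^ n : ℕ) : ℤ) := by exact_mod_cast h3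
        rw [Nat.cast_mul, h1]
        have hp : (0 : ℤ) < p - 1 := by omega
        nlinarith)
    rw [← pow_mul, ← pow_succ] at h2
    have h3 := le_of_ge_of_eq w h2 hc'
    have : ((p ^ (i + 1 + 1) : ℕ) : ℤ) = p * ((p ^ (i + 1) : ℕ) : ℤ) := by push_cast; ring
    omega

lemma gk_bound (S : Gal p n K L w ϖ e g Δ) {k : ℕ} (h0 : 0 < k) (h1 : k < p ^ n) :
    ∃ c : ℤ, w ((g ^ k) ϖ - ϖ) = (c : WithTop ℤ) ∧ c ≤ ((p * Nat.gcd k (p ^ n) : ℕ) : ℤ) := by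
  have hpp := S.core.prime
  obtain ⟨c, -, hc⟩ := S.core.exists_c (S.gpow_ne h0 h1)
  refine ⟨_, hc, ?_⟩
  obtain ⟨i, -, hi⟩ := (Nat.dvd_prime_pow hpp).1 (Nat.gcd_dvd_right k (p ^ n))
  rw [hi]
  have hin : i < n := by
    by_contra h
    have h2 : p ^ i ≤ k := hi ▸ Nat.le_of_dvd h0 (Nat.gcd_dvd_left k (p ^ n))
    have : p ^ n ≤ p ^ i := Nat.pow_le_pow_right hpp.pos (by omega)
    omega
  have hmem : g ^ (p ^ i) ∈ Subgroup.zpowers (g ^ k) := by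
    have hb := Nat.gcd_eq_gcd_ab k (p ^ n)
    rw [hi] at hb
    refine ⟨Nat.gcdA k (p ^ n), ?_⟩
    show (g ^ k) ^ (Nat.gcdA k (p ^ n)) = _
    have h3 : g ^ (p ^ n) = 1 := by rw [← S.hg, pow_orderOf_eq_one]
    rw [← zpow_natCast g (p ^ i), hb, zpow_add, zpow_mul, zpow_mul, zpow_natCast, zpow_natCast, h3, one_zpow,
      mul_one]
  obtain ⟨t, ht⟩ := (mem_powers_iff_mem_zpowers.2 hmem)
  have ht' : (g ^ k) ^ t = g ^ p ^ i := ht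
  have h4 := S.core.c_pow hc.ge t
  rw [ht'] at h4
  have hne : g ^ (p ^ i) ≠ 1 := S.gpow_ne (Nat.pow_pos hpp.pos) (Nat.pow_lt_pow_right hpp.one_lt hin)
  obtain ⟨c', -, hc'⟩ := S.core.exists_c hne
  have h5 := le_of_ge_of_eq w h4 hc'
  have h6 := S.breaks (n - 1 - i) i (by omega) c' hc'
  rw [← pow_succ']
  omega

end Gal

lemma gcd_sum (p : ℕ) (hp : p.Prime) (n : ℕ) :
    p * ∑ k ∈ Finset.range (p ^ n), Nat.gcd k (p ^ n) = p ^ n * (n * (p - 1) + p) := by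
  induction n with
  | zero => simp
  | succ n ih =>
    have h1 : ∀ N : ℕ, ∑ k ∈ Finset.range (N * p), Nat.gcd k (p ^ (n + 1)) =
        ∑ k ∈ Finset.range N, (p * Nat.gcd k (p ^ n) + (p - 1)) := by
      intro N
      induction N with
      | zero => simp
      | succ N ihN =>
        rw [add_mul, one_mul, Finset.sum_range_add, ihN, Finset.sum_range_succ]
        congr 1
        obtain ⟨q, rfl⟩ : ∃ q, p = q + 1 := ⟨p - 1, by have := hp.pos; omega⟩
        rw [Finset.sum_range_succ', add_comm]
        congr 1
        · rw [add_zero, pow_succ', mul_comm N, Nat.gcd_mul_left]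
        · rw [Finset.sum_congr rfl (g := fun _ => 1), Finset.sum_const, Finset.card_range]
          · simp
          · intro i hi
            rw [Finset.mem_range] at hi
            apply Nat.Coprime.pow_right
            apply Nat.Coprime.symm
            rw [hp.coprime_iff_not_dvd]
            intro hd
            have : q + 1 ∣ i + 1 := (Nat.dvd_add_right (Dvd.intro_left N rfl)).1 hd
            have := Nat.le_of_dvd (by omega) this
            omega
    have h2 := h1 (p ^ n)
    rw [← pow_succ] at h2
    rw [h2, Finset.sum_add_distrib, ← Finset.mul_sum, ih]
    simp only [Finset.sum_const, Finset.card_range, smul_eq_mul]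
    ring

end S6

set_option linter.unusedSectionVars false

namespace S6

namespace Gal

variable {p n : ℕ} {K L : Type} [Field K] [Field L] [Algebra K L]
    {w : AddValuation L (WithTop ℤ)} {ϖ : L} {e : ℕ} {g : L ≃ₐ[K] L}
    {Δ : Subgroup (L ≃ₐ[K] L)} [FiniteDimensional K L] [IsGalois K L]

lemma compl (S : Gal p n K L w ϖ e g Δ) : Subgroup.IsComplement' Δ (Subgroup.zpowers g) := by
  apply Subgroup.isComplement'_of_coprime
  · rw [S.hΔ, Nat.card_zpowers, S.hg, S.core.card_aut, S.he]
  · rw [S.hΔ, Nat.card_zpowers, S.hg]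
    exact ((S.core.prime.coprime_iff_not_dvd).2 S.not_dvd).symm.pow_right n

lemma decomp (S : Gal p n K L w ϖ e g Δ) (σ : L ≃ₐ[K] L) :
    ∃ k < p ^ n, ∃ ρ : Δ, ρ * g ^ k = σ := by
  classical
  obtain ⟨⟨ρ, h⟩, hσ⟩ := (Subgroup.isComplement'_def.1 S.compl).2 σ
  have := mem_zpowers_iff_mem_range_orderOf.1 h.2
  rw [S.hg] at this
  simp only [Finset.mem_image, Finset.mem_range] at this
  obtain ⟨k, hk, hk2⟩ := this
  exact ⟨k, hk, ρ, by rw [← hσ, hk2]⟩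

open Classical in
lemma sum_G (S : Gal p n K L w ϖ e g Δ) {M : Type*} [AddCommMonoid M] (f : (L ≃ₐ[K] L) → M) :
    ∑ σ, f σ = ∑ k ∈ Finset.range (p ^ n), ∑ ρ : Δ, f (ρ * g ^ k) := by
  have hb := (Subgroup.isComplement'_def.1 S.compl).1
  rw [← Finset.sum_product' (f := fun k (ρ : Δ) => f (ρ * g ^ k))]
  symm
  apply Finset.sum_bij (fun (x : ℕ × Δ) _ => (x.2 : L ≃ₐ[K] L) * g ^ x.1)
  · intro x _; exact Finset.mem_univ _
  · rintro ⟨k, ρ⟩ h1 ⟨k', ρ'⟩ h2 h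
    simp only [Finset.mem_product, Finset.mem_range] at h1 h2
    have := @hb (ρ, ⟨g ^ k, Subgroup.pow_mem _ (Subgroup.mem_zpowers g) k⟩)
      (ρ', ⟨g ^ k', Subgroup.pow_mem _ (Subgroup.mem_zpowers g) k'⟩) h
    simp only [Prod.mk.injEq, Subtype.mk.injEq] at this
    have hk := pow_injOn_Iio_orderOf (x := g) (by rw [S.hg]; exact h1.1)
      (by rw [S.hg]; exact h2.1) this.2
    rw [hk, this.1]
  · intro σ _
    obtain ⟨k, hk, ρ, h⟩ := S.decomp σ
    exact ⟨(k, ρ), by simp [hk], h⟩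
  · intros; rfl

open Classical in
/-- derivative of the minimal polynomial at the uniformizer -/
noncomputable def Dd (K : Type) {L : Type} [Field K] [Field L] [Algebra K L] [FiniteDimensional K L]
    (ϖ : L) : L :=
  ∏ τ ∈ Finset.univ.erase (1 : L ≃ₐ[K] L), (ϖ - τ ϖ)

lemma wD (S : Gal p n K L w ϖ e g Δ) :
    ∃ d : ℤ, w (Dd K ϖ) = (d : WithTop ℤ) ∧ d ≤ (n + 1) * e - ((p ^ n : ℕ) : ℤ) := by
  classical
  have hp3 := S.p3
  have h1 : ∀ τ : L ≃ₐ[K] L, ∃ r : ℤ, (τ = 1 → r = 0) ∧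
      (τ ≠ 1 → w (ϖ - τ ϖ) = (r : WithTop ℤ)) := by
    intro τ
    by_cases h : τ = 1
    · exact ⟨0, by simp [h], by simp [h]⟩
    · obtain ⟨c, -, hc⟩ := S.core.exists_c h
      exact ⟨1 + c, fun h' => absurd h' h, fun _ => by rw [w.map_sub_swap, hc]⟩
  choose r hr1 hr2 using h1
  refine ⟨∑ τ ∈ Finset.univ.erase (1 : L ≃ₐ[K] L), r τ, ?_, ?_⟩
  · exact eq_prod w _ _ (fun τ hτ => hr2 τ (Finset.ne_of_mem_erase hτ))
  rw [Finset.sum_erase _ (hr1 1 rfl), S.sum_G]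
  have hk : ∀ k ∈ Finset.range (p ^ n), ∑ ρ : Δ, r (ρ * g ^ k) ≤
      (if k = 0 then 0 else ((p * Nat.gcd k (p ^ n) : ℕ) : ℤ)) + ((p : ℤ) - 2) := by
    intro k hk
    rw [Finset.mem_range] at hk
    rw [← Finset.add_sum_erase _ _ (Finset.mem_univ (1 : Δ))]
    apply add_le_add
    · simp only [Subgroup.coe_one, one_mul]
      split_ifs with h
      · rw [h, hr1 _ (pow_zero g)]
      · obtain ⟨c, hc, hc2⟩ := S.gk_bound (by omega) hk
        have h3 := hr2 _ (S.gpow_ne (by omega) hk)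
        rw [w.map_sub_swap] at h3
        rwa [eq_unique w h3 hc]
    · calc _ ≤ ∑ ρ ∈ Finset.univ.erase (1 : Δ), (1 : ℤ) := by
            apply Finset.sum_le_sum
            intro ρ hρ
            have hρ1 : (ρ : L ≃ₐ[K] L) ≠ 1 := fun h => Finset.ne_of_mem_erase hρ (Subtype.ext h)
            have ht := S.tameΔ ρ.2 hρ1
            by_cases hone : (ρ : L ≃ₐ[K] L) * g ^ k = 1
            · rw [hr1 _ hone]; norm_num
            · by_contra hlt
              push Not at hlt
              have h3 := hr2 _ hone
              rw [w.map_sub_swap] at h3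
              have h4 : ((2 : ℤ) : WithTop ℤ) ≤ w (((ρ : L ≃ₐ[K] L) * g ^ k) ϖ - ϖ) := by
                rw [h3]; exact WithTop.coe_le_coe.2 (by omega)
              have h5 : ((2 : ℤ) : WithTop ℤ) ≤ w ((g ^ k)⁻¹ ϖ - ϖ) :=
                S.core.c_inv (S.core.c_pow (ge_mono w S.hgw (by omega)) k)
              have h6 := S.core.c_mul h4 h5
              rw [mul_inv_cancel_right] at h6
              have := le_of_ge_of_eq w h6 ht
              omega
        _ = _ := by
            rw [Finset.sum_const, Finset.card_erase_of_mem (Finset.mem_univ _), Finset.card_univ,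
              ← Nat.card_eq_fintype_card, S.hΔ]
            simp only [nsmul_eq_mul, mul_one]
            omega
  refine (Finset.sum_le_sum hk).trans ?_
  rw [Finset.sum_add_distrib]
  have hs := gcd_sum p S.core.prime n
  have hpos : 0 < p ^ n := Nat.pow_pos (by omega)
  have h0 : (0 : ℕ) ∈ Finset.range (p ^ n) := Finset.mem_range.2 hpos
  have hs1 : ∑ k ∈ Finset.range (p ^ n), (if k = 0 then (0 : ℤ) else ((p * Nat.gcd k (p ^ n) : ℕ) : ℤ))
      = ((p ^ n * (n * (p - 1) + p) : ℕ) : ℤ) - ((p * p ^ n : ℕ) : ℤ) := by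
    rw [← hs, ← Finset.add_sum_erase _ _ h0, if_pos rfl, zero_add, Finset.mul_sum,
      ← Finset.add_sum_erase _ (fun i => p * Nat.gcd i (p ^ n)) h0, Nat.gcd_zero_left]
    push_cast
    rw [add_sub_cancel_left]
    apply Finset.sum_congr rfl
    intro k hk
    rw [if_neg (Finset.ne_of_mem_erase hk)]
  rw [hs1, S.he, Finset.sum_const, Finset.card_range]
  obtain ⟨q, rfl⟩ : ∃ q, p = q + 1 := ⟨p - 1, by omega⟩
  simp only [Nat.add_sub_cancel, nsmul_eq_mul]
  push_cast
  apply le_of_eq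
  ring

lemma traceD (S : Gal p n K L w ϖ e g Δ) :
    Algebra.trace K L (ϖ ^ (e - 1) / Dd K ϖ) = 1 := by
  classical
  apply (algebraMap K L).injective
  rw [trace_eq_sum_automorphisms, map_one]
  have hcard : (Finset.univ : Finset (L ≃ₐ[K] L)).card = e := by
    rw [Finset.card_univ, ← Nat.card_eq_fintype_card, S.core.card_aut]
  have hinj : Set.InjOn (fun σ : L ≃ₐ[K] L => σ ϖ) (Finset.univ : Finset (L ≃ₐ[K] L)) := by
    intro σ _ τ _ h
    have : τ⁻¹ * σ = 1 := by
      apply S.core.eq_of_fix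
      rw [AlgEquiv.mul_apply]
      simp only at h
      rw [h, ← AlgEquiv.mul_apply, inv_mul_cancel, AlgEquiv.one_apply]
    exact (inv_mul_eq_one.1 this).symm
  have he := S.core.epos
  have := Lagrange.coeff_eq_sum hinj (P := (Polynomial.X : Polynomial L) ^ (e - 1)) (by
    rw [Polynomial.degree_X_pow, hcard]; exact_mod_cast (by omega))
  rw [hcard, Polynomial.coeff_X_pow, if_pos rfl] at this
  rw [this]
  apply Finset.sum_congr rfl
  intro σ _
  rw [map_div₀, map_pow, Polynomial.eval_pow, Polynomial.eval_X, Dd, map_prod]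
  congr 1
  apply Finset.prod_bij (fun τ _ => σ * τ)
  · intro τ hτ
    rw [Finset.mem_erase] at hτ ⊢
    exact ⟨fun h => hτ.1 (by simpa using h), Finset.mem_univ _⟩
  · intro a _ b _ h; exact mul_left_cancel h
  · intro b hb
    rw [Finset.mem_erase] at hb
    refine ⟨σ⁻¹ * b, ?_, by group⟩
    rw [Finset.mem_erase]
    exact ⟨fun h => hb.1 (inv_mul_eq_one.1 h).symm, Finset.mem_univ _⟩
  · intro τ _
    rw [map_sub, AlgEquiv.mul_apply]

lemma fixed_val (S : Gal p n K L w ϖ e g Δ) {U : L} (hU : g U = U) {u : ℤ}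
    (hu : w U = (u : WithTop ℤ)) : ((p ^ n : ℕ) : ℤ) ∣ u := by
  classical
  have hp3 := S.p3
  have hk : ∀ k : ℕ, (g ^ k) U = U := by
    intro k
    induction k with
    | zero => rfl
    | succ k ih => rw [pow_succ, AlgEquiv.mul_apply, hU, ih]
  have hN : ∀ σ : L ≃ₐ[K] L, σ (∏ ρ : Δ, (ρ : L ≃ₐ[K] L) U) = ∏ ρ : Δ, (ρ : L ≃ₐ[K] L) U := by
    intro σ
    obtain ⟨k, -, ρ', rfl⟩ := S.decomp σ
    rw [map_prod]
    rw [← Equiv.prod_comp (Equiv.mulLeft ρ') (fun ρ : Δ => (ρ : L ≃ₐ[K] L) U)]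
    apply Finset.prod_congr rfl
    intro ρ _
    rw [← AlgEquiv.mul_apply, mul_assoc, S.hab (g ^ k), ← mul_assoc, AlgEquiv.mul_apply, hk]
    rfl
  obtain ⟨k, hk⟩ := (IsGalois.mem_range_algebraMap_iff_fixed (F := K) _).2 hN
  have hv := eq_prod w Finset.univ (fun ρ : Δ => (ρ : L ≃ₐ[K] L) U) (r := fun _ => u)
    (fun ρ _ => by rw [S.core.inv]; exact hu)
  rw [← hk, Finset.sum_const, Finset.card_univ, ← Nat.card_eq_fintype_card, S.hΔ] at hv
  have hk0 : k ≠ 0 := by rintro rfl; rw [map_zero, w.map_zero] at hv; exact absurd hv.symm WithTop.coe_ne_top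
  obtain ⟨m, hm⟩ := S.core.valK k hk0
  have h := eq_unique w hv hm
  rw [S.he] at h
  refine ⟨m, ?_⟩
  have hp1 : ((p - 1 : ℕ) : ℤ) ≠ 0 := by omega
  apply mul_left_cancel₀ hp1
  rw [nsmul_eq_mul] at h
  rw [h]; push_cast; ring

lemma y_val (S : Gal p n K L w ϖ e g Δ) {a : L} {a0 : ℤ} (ha : w a = (a0 : WithTop ℤ))
    (h1 : 1 ≤ a0) (h2 : a0 < p) :
    ∃ m : ℤ, w (∑ i ∈ Finset.range (p ^ (n - 1)), (g ^ i) a) = (m : WithTop ℤ) ∧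
      1 ≤ m ∧ m < ((p ^ n : ℕ) : ℤ) := by
  have hp3 := S.p3
  have hn1 := S.n1
  set y := ∑ i ∈ Finset.range (p ^ (n - 1)), (g ^ i) a with hy
  have hgy : g y - y = (g ^ (p ^ (n - 1))) a - a := by
    rw [hy, map_sum, ← Finset.sum_sub_distrib]
    have := Finset.sum_range_sub (fun i => (g ^ i) a) (p ^ (n - 1))
    rw [pow_zero, AlgEquiv.one_apply] at this
    rw [← this]
    apply Finset.sum_congr rfl
    intro i _
    rw [pow_succ', AlgEquiv.mul_apply]
  have hlt : p ^ (n - 1) < p ^ n := Nat.pow_lt_pow_right (by omega) (by omega)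
  obtain ⟨c, -, hc⟩ := S.core.exists_c (S.gpow_ne (Nat.pow_pos (by omega)) hlt)
  have hcb := S.breaks 0 (n - 1) (by omega) c hc
  rw [show n - 1 + 1 = n by omega] at hcb
  have hcl := le_of_ge_of_eq w (S.core.c_pow S.hgw (p ^ (n - 1))) hc
  have hv := S.core.eq_sub S.pe (by omega) hc ha (by
    intro h; have := Int.le_of_dvd (by omega) h; omega)
  rw [← hgy] at hv
  have hy0 : y ≠ 0 := by
    intro h
    have := ne_zero_of_eq w hv
    rw [h] at this; simp at this
  obtain ⟨m, hm⟩ := exists_eq w hy0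
  refine ⟨m, hm, ?_, ?_⟩
  · apply le_of_ge_of_eq w _ hm
    apply w.map_le_sum
    intro i _
    rw [S.core.inv, ha]
    exact WithTop.coe_le_coe.2 h1
  · have := le_of_ge_of_eq w (S.core.ge_sub (c := (p : ℤ) - 1) (by omega)
      (by rw [add_sub_cancel]; exact S.hgw) hm.ge) hv
    omega

/-- the element T -/
noncomputable def TT (p n : ℕ) (g : L ≃ₐ[K] L) (a : L) : L :=
  ∑ k ∈ Finset.range (p ^ n), (g ^ k) a -
    (p : L) * ∑ i ∈ Finset.range (p ^ (n - 1)), (g ^ ((p - 1) * p ^ (n - 1) + i)) a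

lemma T_val (S : Gal p n K L w ϖ e g Δ) {a : L} {a0 : ℤ} (ha : w a = (a0 : WithTop ℤ))
    (h1 : 1 ≤ a0) (h2 : a0 < p) :
    ∃ t : ℤ, w (TT p n g a) = (t : WithTop ℤ) ∧ t ≤ e + ((p ^ n : ℕ) : ℤ) - 1 := by
  obtain ⟨m, hm, hm1, hm2⟩ := S.y_val ha h1 h2
  set U := ∑ k ∈ Finset.range (p ^ n), (g ^ k) a with hU
  set V := ∑ i ∈ Finset.range (p ^ (n - 1)), (g ^ ((p - 1) * p ^ (n - 1) + i)) a with hV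
  have hV' : w V = (m : WithTop ℤ) := by
    rw [← hm, ← S.core.inv (g ^ ((p - 1) * p ^ (n - 1))) (∑ i ∈ Finset.range (p ^ (n - 1)), (g ^ i) a), hV]
    congr 1
    rw [map_sum]
    apply Finset.sum_congr rfl
    intro i _
    rw [pow_add, AlgEquiv.mul_apply]
  have hpV := eq_mul w S.core.valp hV'
  have hgU : g U = U := by
    have h3 : g U - U = 0 := by
      have := Finset.sum_range_sub (fun i => (g ^ i) a) (p ^ n)
      rw [pow_zero, AlgEquiv.one_apply, ← S.hg, pow_orderOf_eq_one, AlgEquiv.one_apply, sub_self, S.hg] at this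
      rw [hU, map_sum, ← Finset.sum_sub_distrib, ← this]
      apply Finset.sum_congr rfl
      intro i _
      rw [pow_succ', AlgEquiv.mul_apply]
    exact sub_eq_zero.1 h3
  show ∃ t : ℤ, w (U - (p : L) * V) = _ ∧ _
  by_cases hU0 : U = 0
  · refine ⟨e + m, ?_, by omega⟩
    rw [hU0, zero_sub, w.map_neg, hpV]
  obtain ⟨u, hu⟩ := exists_eq w hU0
  have hdu := S.fixed_val hgU hu
  have hde : ((p ^ n : ℕ) : ℤ) ∣ (e : ℤ) := by
    rw [S.he]; push_cast; exact Dvd.intro_left _ rfl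
  have hne : u ≠ e + m := by
    rintro rfl
    have := (Int.dvd_add_right hde).1 hdu
    have := Int.le_of_dvd (by omega) this
    omega
  rcases lt_or_gt_of_ne hne with h | h
  · refine ⟨u, ?_, by omega⟩
    rw [sub_eq_add_neg]
    exact eq_add_left w hu (by rw [w.map_neg, hpV]) h
  · refine ⟨e + m, ?_, by omega⟩
    rw [w.map_sub_swap, sub_eq_add_neg]
    exact eq_add_left w hpV (by rw [w.map_neg, hu]) h

lemma exists_beta (S : Gal p n K L w ϖ e g Δ) {a : L} {a0 : ℤ} (ha : w a = (a0 : WithTop ℤ))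
    (h1 : 1 ≤ a0) (h2 : a0 < p) :
    ∃ β : L, ((0 : ℤ) : WithTop ℤ) ≤ w β ∧
      Algebra.trace K L (TT p n g a * β) = (p : K) ^ (n + 1) := by
  obtain ⟨t, ht, ht2⟩ := S.T_val ha h1 h2
  obtain ⟨d, hd, hd2⟩ := S.wD
  have he := S.core.epos
  have hT0 := ne_zero_of_eq w ht
  refine ⟨(p : L) ^ (n + 1) * (ϖ ^ (e - 1) / Dd K ϖ) / TT p n g a, ?_, ?_⟩
  · rw [eq_div w (eq_mul w (eq_pow w S.core.valp (n + 1)) (eq_div w (S.core.val_pow (e - 1)) hd)) ht]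
    apply WithTop.coe_le_coe.2
    rw [nsmul_eq_mul]
    push_cast [show 1 ≤ e by omega]
    push_cast at hd2 ht2
    linarith
  · rw [mul_div_cancel₀ _ hT0]
    have : (p : L) ^ (n + 1) = algebraMap K L ((p : K) ^ (n + 1)) := by simp
    rw [this, ← Algebra.smul_def, map_smul, S.traceD]
    simp

end Gal
end S6

set_option linter.unusedSectionVars false

namespace S6

section zeta

variable {A : Type} [Field A] (v : AddValuation A (WithTop ℚ))

lemma v_root {ζ : A} {N : ℕ} (hN : 0 < N) (h : ζ ^ N = 1) : v ζ = ((0 : ℚ) : WithTop ℚ) := by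
  have h0 : ζ ≠ 0 := by rintro rfl; rw [zero_pow hN.ne'] at h; exact zero_ne_one h
  obtain ⟨r, hr⟩ := exists_eq v h0
  have := eq_pow v hr N
  rw [h, v.map_one, ← WithTop.coe_zero, WithTop.coe_inj, nsmul_eq_mul] at this
  have hN' : (N : ℚ) ≠ 0 := by exact_mod_cast hN.ne'
  rcases mul_eq_zero.1 this.symm with h | h
  · exact absurd h hN'
  · rw [hr, h]

lemma v_pow_sub {ζ : A} {N : ℕ} (hN : 0 < N) (h : ζ ^ N = 1) (j : ℕ) : v (1 - ζ) ≤ v (1 - ζ ^ j) := by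
  have h1 : 1 - ζ ^ j = (1 - ζ) * ∑ i ∈ Finset.range j, ζ ^ i := by
    rw [mul_comm, geom_sum_mul_neg]
  rw [h1, v.map_mul]
  have : (0 : WithTop ℚ) ≤ v (∑ i ∈ Finset.range j, ζ ^ i) := by
    apply v.map_le_sum
    intro i _
    rw [eq_pow v (v_root v hN h) i]; simp
  calc v (1 - ζ) = v (1 - ζ) + 0 := by simp
    _ ≤ _ := by gcongr

lemma zeta_val {p : ℕ} (hp : p.Prime) (hvp : v (p : A) = ((1 : ℚ) : WithTop ℚ)) {n : ℕ} (hn : 1 ≤ n)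
    {ζ : A} (hζ : IsPrimitiveRoot ζ (p ^ n)) :
    v (ζ - 1) = ((1 / (((p - 1) * p ^ (n - 1) : ℕ) : ℚ) : ℚ) : WithTop ℚ) := by
  have : Fact p.Prime := ⟨hp⟩
  have hpos : 0 < p ^ n := Nat.pow_pos hp.pos
  obtain ⟨m, rfl⟩ : ∃ m, n = m + 1 := ⟨n - 1, by omega⟩
  have hcyc := Polynomial.eval_one_cyclotomic_prime_pow (R := A) (p := p) m
  rw [Polynomial.cyclotomic_eq_prod_X_sub_primitiveRoots hζ, Polynomial.eval_prod] at hcyc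
  simp only [Polynomial.eval_sub, Polynomial.eval_X, Polynomial.eval_C] at hcyc
  have hne : 1 - ζ ≠ 0 := by
    intro h
    have h1 : ζ = 1 := (sub_eq_zero.1 h).symm
    rw [h1] at hζ
    have := hζ.eq_orderOf
    rw [orderOf_one] at this
    have h2 := Nat.one_lt_pow (n := m + 1) (by omega) hp.one_lt
    omega
  obtain ⟨r, hr⟩ := exists_eq v hne
  have hall : ∀ μ ∈ primitiveRoots (p ^ (m + 1)) A, v (1 - μ) = (r : WithTop ℚ) := by
    intro μ hμ
    have hμ' := isPrimitiveRoot_of_mem_primitiveRoots hμ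
    obtain ⟨i, -, hi⟩ := hζ.eq_pow_of_pow_eq_one hμ'.pow_eq_one
    obtain ⟨j, -, hj⟩ := hμ'.eq_pow_of_pow_eq_one hζ.pow_eq_one
    rw [← hr]
    apply le_antisymm
    · rw [← hj]; exact v_pow_sub v hpos hμ'.pow_eq_one j
    · rw [← hi]; exact v_pow_sub v hpos hζ.pow_eq_one i
  have h3 := eq_prod v _ _ hall
  rw [hcyc, Finset.sum_const, hζ.card_primitiveRoots, Nat.totient_prime_pow_succ hp] at h3
  have h4 := eq_unique v hvp h3
  rw [v.map_sub_swap, hr, WithTop.coe_inj, Nat.add_sub_cancel]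
  rw [nsmul_eq_mul] at h4
  rw [mul_comm (p - 1)]
  have : ((p ^ m * (p - 1) : ℕ) : ℚ) ≠ 0 := by
    intro h; rw [h] at h4; simp at h4
  field_simp
  linarith

/-- values in the cyclotomic extension -/
lemma taylor_val {K : Type} [Field K] (f : K →+* A)
    (hint : ∀ k : K, k ≠ 0 → ∃ m : ℤ, v (f k) = ((m : ℚ) : WithTop ℚ))
    {E : ℕ} (hE : 0 < E) {ζ : A} (hζ : v (ζ - 1) = ((1 / (E : ℚ) : ℚ) : WithTop ℚ))
    (R : Polynomial K) (hdeg : R.natDegree < E) (hR : R.eval 1 ≠ 0) :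
    ∃ m : ℤ, v (R.eval₂ f ζ) = (((m : ℚ) / E : ℚ) : WithTop ℚ) ∧
      v (R.eval₂ f ζ) ≤ v (f (R.eval 1)) := by
  set r := Polynomial.taylor 1 R with hr
  have hrdeg : r.natDegree < E := by rw [hr, Polynomial.natDegree_taylor]; exact hdeg
  have h0 : r.coeff 0 = R.eval 1 := by rw [hr, Polynomial.taylor_coeff_zero]
  have hS : R.eval₂ f ζ = ∑ j ∈ Finset.range E, f (r.coeff j) * (ζ - 1) ^ j := by
    have h1 := Polynomial.sum_taylor_eq R (1 : K)
    rw [← hr, Polynomial.sum_over_range' _ _ E hrdeg] at h1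
    · conv_lhs => rw [← h1]
      rw [Polynomial.eval₂_finsetSum]
      apply Finset.sum_congr rfl
      intro j _
      rw [Polynomial.eval₂_mul, Polynomial.eval₂_pow, Polynomial.eval₂_sub, Polynomial.eval₂_X,
        Polynomial.eval₂_C, Polynomial.eval₂_C, map_one]
    · simp
  have hEq : (E : ℚ) ≠ 0 := by exact_mod_cast hE.ne'
  have hterm : ∀ j, r.coeff j ≠ 0 → ∃ m : ℤ, v (f (r.coeff j) * (ζ - 1) ^ j) =
      (((m * E + j : ℤ) : ℚ) / E : ℚ) := by
    intro j hj
    obtain ⟨m, hm⟩ := hint _ hj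
    refine ⟨m, ?_⟩
    rw [eq_mul v hm (eq_pow v hζ j)]
    congr 1
    rw [nsmul_eq_mul]; push_cast
    field_simp
  have hcoef : ∀ j, f (r.coeff j) * (ζ - 1) ^ j ≠ 0 → r.coeff j ≠ 0 := by
    intro j h h'; apply h; rw [h']; simp
  obtain ⟨i, hi, hi0, hi1, hi2, -⟩ := sum_distinct v (Finset.range E)
    (fun j => f (r.coeff j) * (ζ - 1) ^ j) (by
      intro i hi j hj hij hfi hfj heq
      obtain ⟨m, hm⟩ := hterm i (hcoef i hfi)
      obtain ⟨m', hm'⟩ := hterm j (hcoef j hfj)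
      rw [hm, hm', WithTop.coe_inj, div_left_inj' hEq] at heq
      have heq' : m * E + i = m' * E + j := by exact_mod_cast heq
      rw [Finset.mem_range] at hi hj
      apply hij
      have e1 : (m * E + i) % (E : ℤ) = i := by
        rw [add_comm, Int.add_mul_emod_self_right]; exact Int.emod_eq_of_lt (by omega) (by omega)
      have e2 : (m' * E + j) % (E : ℤ) = j := by
        rw [add_comm, Int.add_mul_emod_self_right]; exact Int.emod_eq_of_lt (by omega) (by omega)
      rw [heq', e2] at e1
      omega) ⟨0, Finset.mem_range.2 hE, by
        rw [pow_zero, mul_one, h0]; simpa using hR⟩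
  rw [← hS] at hi1
  obtain ⟨m, hm⟩ := hterm i (hcoef i hi0)
  refine ⟨m * E + i, ?_, ?_⟩
  · rw [hi1]; exact hm
  · rw [hi1]
    have := hi2 0 (Finset.mem_range.2 hE)
    simpa [h0] using this

/-- reduction of a sum of roots of unity -/
lemma reduce_val {p : ℕ} (hp : p.Prime) (hvp : v (p : A) = ((1 : ℚ) : WithTop ℚ)) {n : ℕ} (hn : 1 ≤ n)
    {ζ : A} (hζ : IsPrimitiveRoot ζ (p ^ n)) {K : Type} [Field K] (f : K →+* A)
    (hint : ∀ k : K, k ≠ 0 → ∃ m : ℤ, v (f k) = ((m : ℚ) : WithTop ℚ))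
    (c : ℕ → K) (R1 : K) (hR1 : R1 = ∑ k ∈ Finset.range (p ^ n), c k -
      (p : K) * ∑ i ∈ Finset.range (p ^ (n - 1)), c ((p - 1) * p ^ (n - 1) + i)) (h0 : R1 ≠ 0) :
    ∃ m : ℤ, v (∑ k ∈ Finset.range (p ^ n), ζ ^ k * f (c k)) =
        (((m : ℚ) / ((p - 1) * p ^ (n - 1) : ℕ) : ℚ) : WithTop ℚ) ∧
      v (∑ k ∈ Finset.range (p ^ n), ζ ^ k * f (c k)) ≤ v (f R1) := by
  have hz := zeta_val v hp hvp hn hζ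
  have hp2 := hp.two_le
  set q := p ^ (n - 1) with hq
  have hq0 : 0 < q := Nat.pow_pos hp.pos
  have hpq : p ^ n = (p - 1) * q + q := by
    rw [hq, ← Nat.succ_mul, Nat.succ_eq_add_one, Nat.sub_add_cancel (by omega), ← pow_succ',
      Nat.sub_add_cancel hn]
  set E := (p - 1) * q with hE
  have hE0 : 0 < E := Nat.mul_pos (by omega) hq0
  let R : Polynomial K := ∑ k ∈ Finset.range E, Polynomial.C (c k) * Polynomial.X ^ k -
    ∑ i ∈ Finset.range q, ∑ j ∈ Finset.range (p - 1),
      Polynomial.C (c (E + i)) * Polynomial.X ^ (i + q * j)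
  have hdeg : R.natDegree < E := by
    have hle : R.natDegree ≤ E - 1 := by
      apply (Polynomial.natDegree_sub_le _ _).trans
      apply max_le
      · apply Polynomial.natDegree_sum_le_of_forall_le
        intro k hk
        rw [Finset.mem_range] at hk
        exact (Polynomial.natDegree_C_mul_X_pow_le _ _).trans (by omega)
      · apply Polynomial.natDegree_sum_le_of_forall_le
        intro i hi
        apply Polynomial.natDegree_sum_le_of_forall_le
        intro j hj
        rw [Finset.mem_range] at hi hj
        apply (Polynomial.natDegree_C_mul_X_pow_le _ _).trans
        have : q * (j + 1) ≤ E := by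
          rw [hE, mul_comm (p - 1)]; exact Nat.mul_le_mul_left q (by omega)
        rw [mul_add, mul_one] at this
        omega
    omega
  have hev : R.eval 1 = R1 := by
    rw [hR1, hpq, Finset.sum_range_add]
    simp only [R, Polynomial.eval_sub, Polynomial.eval_finsetSum, Polynomial.eval_mul, Polynomial.eval_C,
      Polynomial.eval_pow, Polynomial.eval_X, one_pow, mul_one, Finset.sum_const, Finset.card_range]
    rw [← Finset.smul_sum, nsmul_eq_mul]
    push_cast [show 1 ≤ p by omega]
    ring
  have hS : R.eval₂ f ζ = ∑ k ∈ Finset.range (p ^ n), ζ ^ k * f (c k) := by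
    have hη : IsPrimitiveRoot (ζ ^ q) p := by
      apply hζ.pow (Nat.pow_pos hp.pos)
      rw [hq, ← pow_succ, Nat.sub_add_cancel hn]
    have hgs := hη.geom_sum_eq_zero hp.one_lt
    rw [show p = (p - 1) + 1 by omega, Finset.sum_range_succ] at hgs
    have hgs' : ζ ^ E = - ∑ j ∈ Finset.range (p - 1), (ζ ^ q) ^ j := by
      rw [hE, mul_comm, pow_mul]; linear_combination hgs
    rw [hpq, Finset.sum_range_add]
    simp only [R, Polynomial.eval₂_sub, Polynomial.eval₂_finsetSum, Polynomial.eval₂_mul, Polynomial.eval₂_C,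
      Polynomial.eval₂_pow, Polynomial.eval₂_X]
    rw [sub_eq_add_neg, ← Finset.sum_neg_distrib]
    congr 1
    · exact Finset.sum_congr rfl (fun k _ => mul_comm _ _)
    · apply Finset.sum_congr rfl
      intro i _
      rw [pow_add ζ E i, hgs', ← Finset.mul_sum]
      simp only [pow_add, pow_mul]
      rw [← Finset.mul_sum]
      ring
  have := taylor_val v f hint hE0 hz R hdeg (by rw [hev]; exact h0)
  rwa [hS, hev] at this

end zeta

section resolvent

variable {A : Type} [Field A] {K L : Type} [Field K] [Field L] [Algebra K L]
  [FiniteDimensional K L] [IsGalois K L]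

lemma res_mul (emb : L →+* A) (χ : (L ≃ₐ[K] L) →* A)
    (α β : L) :
    ∑ γ : L ≃ₐ[K] L, χ γ * (emb.comp (algebraMap K L)) (Algebra.trace K L (γ α * β)) =
    (∑ γ : L ≃ₐ[K] L, χ γ * emb (γ α)) * ∑ γ : L ≃ₐ[K] L, χ γ⁻¹ * emb (γ β) := by
  have h1 : ∀ γ : L ≃ₐ[K] L, χ γ * (emb.comp (algebraMap K L)) (Algebra.trace K L (γ α * β)) =
      ∑ σ : L ≃ₐ[K] L, χ γ * (emb (σ (γ α)) * emb (σ β)) := by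
    intro γ
    rw [RingHom.comp_apply, trace_eq_sum_automorphisms, map_sum, Finset.mul_sum]
    apply Finset.sum_congr rfl
    intro σ _
    rw [map_mul, map_mul]
  rw [Finset.sum_congr rfl (fun γ _ => h1 γ), Finset.sum_comm, Finset.mul_sum]
  apply Finset.sum_congr rfl
  intro σ _
  rw [← Equiv.sum_comp (Equiv.mulLeft σ) (fun γ => χ γ * emb (γ α)), Finset.sum_mul]
  apply Finset.sum_congr rfl
  intro γ _
  simp only [Equiv.coe_mulLeft, map_mul, AlgEquiv.mul_apply]
  have : χ σ * χ σ⁻¹ = 1 := by rw [← map_mul, mul_inv_cancel, map_one]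
  linear_combination (-(χ γ * emb (σ (γ α)) * emb (σ β))) * this

lemma res_shift (emb : L →+* A) (χ : (L ≃ₐ[K] L) →* A)
    (g : L ≃ₐ[K] L) (β : L) :
    ∑ γ : L ≃ₐ[K] L, χ γ⁻¹ * emb (γ (g β)) = χ g * ∑ γ : L ≃ₐ[K] L, χ γ⁻¹ * emb (γ β) := by
  rw [← Equiv.sum_comp (Equiv.mulRight g) (fun γ => χ γ⁻¹ * emb (γ β)), Finset.mul_sum]
  apply Finset.sum_congr rfl
  intro γ _
  simp only [Equiv.coe_mulRight, mul_inv_rev, map_mul, AlgEquiv.mul_apply]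
  have : χ g * χ g⁻¹ = 1 := by rw [← map_mul, mul_inv_cancel, map_one]
  linear_combination (-(χ γ⁻¹ * emb (γ (g β)))) * this

lemma res_Z (emb : L →+* A) (χ : (L ≃ₐ[K] L) →* A)
    (g : L ≃ₐ[K] L) (β : L) (m : ℕ) :
    ∑ γ : L ≃ₐ[K] L, χ γ⁻¹ * emb (γ (Core.Z g m β)) =
      (χ g - 1) ^ m * ∑ γ : L ≃ₐ[K] L, χ γ⁻¹ * emb (γ β) := by
  induction m with
  | zero => simp [Core.Z_zero]
  | succ m ih =>
    have : ∀ γ : L ≃ₐ[K] L, χ γ⁻¹ * emb (γ (Core.Z g (m + 1) β)) =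
        χ γ⁻¹ * emb (γ (g (Core.Z g m β))) - χ γ⁻¹ * emb (γ (Core.Z g m β)) := by
      intro γ
      rw [Core.Z_succ, map_sub, map_sub, mul_sub]
    rw [Finset.sum_congr rfl (fun γ _ => this γ), Finset.sum_sub_distrib, res_shift emb χ, ih]
    ring

variable {p n : ℕ} {w : AddValuation L (WithTop ℤ)} {ϖ : L} {e : ℕ} {g : L ≃ₐ[K] L}
    {Δ : Subgroup (L ≃ₐ[K] L)}

open Classical in
theorem Gal.final (S : Gal p n K L w ϖ e g Δ) (emb : L →+* A) (v : AddValuation A (WithTop ℚ))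
    (hvp : v (p : A) = ((1 : ℚ) : WithTop ℚ))
    (hint : ∀ k : K, k ≠ 0 → ∃ m : ℤ,
      v ((emb.comp (algebraMap K L)) k) = ((m : ℚ) : WithTop ℚ))
    (χ ω ψ : (L ≃ₐ[K] L) →* A) (hχ : χ = ω * ψ) (hωg : ω g = 1) (hψΔ : ∀ ρ ∈ Δ, ψ ρ = 1)
    (hζ : IsPrimitiveRoot (ψ g) (p ^ n)) (α : L) (o : Δ → K)
    (ho : ∀ ρ : Δ, ω ρ = (emb.comp (algebraMap K L)) (o ρ)) {a0 : ℤ}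
    (ha : w (∑ ρ : Δ, algebraMap K L (o ρ) * (ρ : L ≃ₐ[K] L) α) = (a0 : WithTop ℤ))
    (h1 : 1 ≤ a0) (h2 : a0 < p) :
    ∃ β : L, ((0 : ℤ) : WithTop ℤ) ≤ w β ∧
      v (∑ γ : L ≃ₐ[K] L, χ γ * (emb.comp (algebraMap K L)) (Algebra.trace K L (γ α * β))) =
        ((n + 1 : ℚ) : WithTop ℚ) := by
  have hp := S.core.prime
  have hn := S.n1
  set a := ∑ ρ : Δ, algebraMap K L (o ρ) * (ρ : L ≃ₐ[K] L) α with haa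
  set f := emb.comp (algebraMap K L) with hf
  have hχg : χ g = ψ g := by rw [hχ, MonoidHom.mul_apply, hωg, one_mul]
  obtain ⟨β, hβ, hβ2⟩ := S.exists_beta ha h1 h2
  have hsum : ∑ γ : L ≃ₐ[K] L, χ γ * f (Algebra.trace K L (γ α * β)) =
      ∑ k ∈ Finset.range (p ^ n), (ψ g) ^ k * f (Algebra.trace K L ((g ^ k) a * β)) := by
    rw [S.sum_G]
    apply Finset.sum_congr rfl
    intro k _
    have h3 : (g ^ k) a * β = ∑ ρ : Δ, o ρ • (((ρ : L ≃ₐ[K] L) * g ^ k) α * β) := by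
      rw [haa, map_sum, Finset.sum_mul]
      apply Finset.sum_congr rfl
      intro ρ _
      rw [map_mul, AlgEquiv.commutes, Algebra.smul_def, S.hab, AlgEquiv.mul_apply, mul_assoc]
    rw [h3, map_sum, map_sum, Finset.mul_sum]
    apply Finset.sum_congr rfl
    intro ρ _
    rw [map_smul, smul_eq_mul, RingHom.map_mul f, ← ho, χ.map_mul, map_pow, hχg, hχ, MonoidHom.mul_apply,
      hψΔ _ ρ.2]
    ring
  have hR1 : (p : K) ^ (n + 1) = ∑ k ∈ Finset.range (p ^ n), Algebra.trace K L ((g ^ k) a * β) -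
      (p : K) * ∑ i ∈ Finset.range (p ^ (n - 1)),
        Algebra.trace K L ((g ^ ((p - 1) * p ^ (n - 1) + i)) a * β) := by
    rw [← hβ2, Gal.TT, sub_mul, map_sub, Finset.sum_mul, map_sum]
    congr 1
    have : (p : L) = algebraMap K L (p : K) := by simp
    rw [mul_assoc, this, ← Algebra.smul_def, map_smul, smul_eq_mul, Finset.sum_mul, map_sum]
  have hpA : f ((p : K) ^ (n + 1)) = (p : A) ^ (n + 1) := by simp
  have hp0 : (p : K) ^ (n + 1) ≠ 0 := by
    intro h
    rw [h, map_zero] at hpA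
    exact ne_zero_of_eq v (eq_pow v hvp (n + 1)) hpA.symm
  obtain ⟨m, hm, hm2⟩ := reduce_val v hp hvp hn hζ f hint
    (fun k => Algebra.trace K L ((g ^ k) a * β)) _ hR1 hp0
  rw [← hsum] at hm hm2
  rw [hpA, eq_pow v hvp (n + 1), hm, WithTop.coe_le_coe] at hm2
  have hz := zeta_val v hp hvp hn hζ
  set E := (p - 1) * p ^ (n - 1) with hE
  have hE0 : 0 < E := Nat.mul_pos (by have := S.p3; omega) (Nat.pow_pos hp.pos)
  have hEq : (0 : ℚ) < E := by exact_mod_cast hE0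
  rw [div_le_iff₀ hEq, nsmul_eq_mul, mul_one] at hm2
  have hm3 : m ≤ (n + 1) * E := by exact_mod_cast hm2
  obtain ⟨d, hd⟩ := Int.eq_ofNat_of_zero_le (sub_nonneg.2 hm3)
  refine ⟨Core.Z g d β, ?_, ?_⟩
  · have := S.core.ge_Z (c := (p : ℤ) - 1) (by have := S.p3; omega)
      (by rw [add_sub_cancel]; exact S.hgw) hβ d
    refine ge_mono w this ?_
    have := S.p3
    have : (0 : ℤ) ≤ d * ((p : ℤ) - 1) := mul_nonneg (by omega) (by omega)
    omega
  · rw [res_mul emb χ, res_Z emb χ, mul_left_comm, ← res_mul emb χ, hχg,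
      eq_mul v (eq_pow v hz d) hm]
    congr 1
    have hd' : ((n : ℚ) + 1) * E - m = d := by exact_mod_cast hd
    rw [nsmul_eq_mul, ← hd']
    field_simp
    ring

end resolvent
end S6

set_option linter.unusedSectionVars false

namespace S6

section vals

variable {p : ℕ} {A : Type} [Field A]

noncomputable def val (vd : PadicValData A p) : AddValuation A (WithTop ℚ) :=
  AddValuation.of vd.v ((vd.v_top_iff 0).2 rfl) (by
    have h1 : vd.v 1 ≠ ⊤ := fun h => one_ne_zero ((vd.v_top_iff 1).1 h)
    obtain ⟨r, hr⟩ := WithTop.ne_top_iff_exists.1 h1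
    have := vd.v_mul 1 1
    rw [mul_one, ← hr, ← WithTop.coe_add, WithTop.coe_inj] at this
    rw [← hr, ← WithTop.coe_zero, WithTop.coe_inj]
    linarith) vd.v_min_le_add vd.v_mul

lemma val_apply (vd : PadicValData A p) (x : A) : val vd x = vd.v x := rfl

lemma val_p (vd : PadicValData A p) : val vd (p : A) = ((1 : ℚ) : WithTop ℚ) := vd.v_coe_p

lemma val_p_zpow (v : AddValuation A (WithTop ℚ)) (hv : v (p : A) = ((1 : ℚ) : WithTop ℚ)) (m : ℤ) :
    v ((p : A) ^ m) = ((m : ℚ) : WithTop ℚ) := by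
  rcases Int.le_total 0 m with h | h
  · obtain ⟨t, rfl⟩ := Int.eq_ofNat_of_zero_le h
    rw [zpow_natCast, eq_pow v hv t]; simp
  · obtain ⟨t, ht⟩ := Int.eq_ofNat_of_zero_le (Int.neg_nonneg_of_nonpos h)
    obtain rfl : m = -(t : ℤ) := by omega
    rw [zpow_neg, zpow_natCast, eq_inv v (eq_pow v hv t)]; simp

lemma int_of_unram (v : AddValuation A (WithTop ℚ)) (hv : v (p : A) = ((1 : ℚ) : WithTop ℚ))
    {K : Type} [Field K] (f : K →+* A)
    (hmin : ∀ y : K, 0 < v (f y) → v (f (p : K)) ≤ v (f y)) (k : K) (hk : k ≠ 0) :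
    ∃ m : ℤ, v (f k) = ((m : ℚ) : WithTop ℚ) := by
  obtain ⟨r, hr⟩ := exists_eq v ((map_ne_zero f).2 hk)
  refine ⟨⌊r⌋, ?_⟩
  have h1 : v (f (k * (p : K) ^ (-⌊r⌋))) = ((r - ⌊r⌋ : ℚ) : WithTop ℚ) := by
    rw [map_mul, map_zpow₀, map_natCast, eq_mul v hr (val_p_zpow v hv _)]
    congr 1; push_cast; ring
  by_contra hne
  have hne' : r - ⌊r⌋ ≠ 0 := by
    intro h; apply hne; rw [hr]; congr 1; linarith
  have hpos : 0 < r - ⌊r⌋ := lt_of_le_of_ne (sub_nonneg.2 (Int.floor_le r)) (Ne.symm hne')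
  have h2 := hmin _ (by rw [h1]; exact WithTop.coe_lt_coe.2 hpos)
  rw [map_natCast, hv, h1, WithTop.coe_le_coe] at h2
  have := Int.lt_floor_add_one r
  linarith

variable [Fact p.Prime]

lemma exists_sqrt (hp : p ≠ 2) (x : ℤ_[p]) : ∃ s : ℤ_[p], s ^ 2 = 1 + p * x ^ 2 := by
  have hpr : p.Prime := Fact.out
  have h2 : ‖(2 : ℤ_[p])‖ = 1 := by
    have : ‖((2 : ℕ) : ℤ_[p])‖ = 1 := by
      rw [PadicInt.norm_natCast_eq_one_iff]
      exact (Nat.coprime_primes hpr Nat.prime_two).2 hp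
    simpa using this
  obtain ⟨z, hz, -⟩ := hensels_lemma (p := p) (R := ℤ_[p])
    (F := Polynomial.X ^ 2 - Polynomial.C (1 + (p : ℤ_[p]) * x ^ 2)) (a := 1) (by
      simp only [map_sub, map_pow, Polynomial.aeval_X, Polynomial.aeval_C, Polynomial.derivative_X_pow,
        Polynomial.derivative_C, sub_zero, map_mul]
      simp only [one_pow, Algebra.algebraMap_self, RingHom.id_apply]
      rw [sub_add_cancel_left, norm_neg]
      norm_num
      rw [h2]
      have hp1 : ‖(p : ℤ_[p])‖ < 1 := (PadicInt.norm_lt_one_iff_dvd _).2 dvd_rfl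
      have hx := PadicInt.norm_le_one x
      have hx2 : ‖x‖ ^ 2 ≤ 1 := pow_le_one₀ (norm_nonneg _) hx
      have : 0 ≤ ‖x‖ ^ 2 := by positivity
      have hpp : 0 ≤ ‖(p : ℤ_[p])‖ := norm_nonneg _
      rw [PadicInt.norm_p] at hp1 hpp
      nlinarith)
  refine ⟨z, ?_⟩
  simp only [map_sub, map_pow, Polynomial.aeval_X, Polynomial.aeval_C] at hz
  exact sub_eq_zero.1 hz

lemma padic_nonneg (hp : p ≠ 2) (v : AddValuation A (WithTop ℚ))
    (hv : v (p : A) = ((1 : ℚ) : WithTop ℚ)) (f : ℚ_[p] →+* A)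
    (hint : ∀ k : ℚ_[p], k ≠ 0 → ∃ m : ℤ, v (f k) = ((m : ℚ) : WithTop ℚ)) (x : ℤ_[p]) :
    0 ≤ v (f x) := by
  by_contra hlt
  push Not at hlt
  have hx0 : (x : ℚ_[p]) ≠ 0 := by intro h; rw [h] at hlt; simp at hlt
  obtain ⟨m, hm⟩ := hint _ hx0
  rw [hm] at hlt
  have hm0 : m < 0 := by exact_mod_cast WithTop.coe_lt_coe.1 hlt
  obtain ⟨s, hs⟩ := exists_sqrt hp x
  have hs' : (s : ℚ_[p]) ^ 2 = 1 + p * (x : ℚ_[p]) ^ 2 := by exact_mod_cast congrArg (fun z : ℤ_[p] => (z : ℚ_[p])) hs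
  have h1 : v (f (p * (x : ℚ_[p]) ^ 2)) = ((1 + 2 * m : ℚ) : WithTop ℚ) := by
    rw [map_mul, map_natCast, map_pow, eq_mul v hv (eq_pow v hm 2)]; simp [nsmul_eq_mul]
  have h2 : v (f ((s : ℚ_[p]) ^ 2)) = ((1 + 2 * m : ℚ) : WithTop ℚ) := by
    rw [hs', map_add, map_one, add_comm]
    apply eq_add_left v h1 (s := 0) (by simp)
    have : (m : ℚ) ≤ -1 := by exact_mod_cast (by omega : m ≤ -1)
    linarith
  have hs0 : (s : ℚ_[p]) ≠ 0 := by
    intro h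
    have := ne_zero_of_eq v h2
    rw [h] at this; simp at this
  obtain ⟨k, hk⟩ := hint _ hs0
  rw [map_pow, eq_pow v hk 2, WithTop.coe_inj, nsmul_eq_mul] at h2
  have : 2 * k = 1 + 2 * m := by exact_mod_cast h2
  omega

lemma padic_val (hp : p ≠ 2) (v : AddValuation A (WithTop ℚ))
    (hv : v (p : A) = ((1 : ℚ) : WithTop ℚ)) (f : ℚ_[p] →+* A)
    (hint : ∀ k : ℚ_[p], k ≠ 0 → ∃ m : ℤ, v (f k) = ((m : ℚ) : WithTop ℚ)) (x : ℚ_[p]) (hx : x ≠ 0) :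
    v (f x) = ((x.valuation : ℚ) : WithTop ℚ) := by
  have hp0 : (p : ℚ_[p]) ≠ 0 := by exact_mod_cast (Fact.out : p.Prime).ne_zero
  have key : ∀ y : ℚ_[p], y ≠ 0 → ((y.valuation : ℚ) : WithTop ℚ) ≤ v (f y) := by
    intro y hy
    set u := y * (p : ℚ_[p]) ^ (-y.valuation) with hu
    have hun : ‖u‖ ≤ 1 := by
      rw [hu, norm_mul, Padic.norm_p_zpow, Padic.norm_eq_zpow_neg_valuation hy, neg_neg, ← zpow_add₀]
      · simp
      · exact_mod_cast (Fact.out : p.Prime).ne_zero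
    have h1 := padic_nonneg hp v hv f hint ⟨u, hun⟩
    have h2 : y = u * (p : ℚ_[p]) ^ y.valuation := by
      rw [hu, mul_assoc, ← zpow_add₀ hp0, neg_add_cancel, zpow_zero, mul_one]
    conv_rhs => rw [h2]
    rw [map_mul, map_zpow₀, map_natCast, v.map_mul, val_p_zpow v hv]
    calc _ = 0 + ((y.valuation : ℚ) : WithTop ℚ) := by simp
      _ ≤ _ := by gcongr
  obtain ⟨r, hr⟩ := exists_eq v ((map_ne_zero f).2 hx)
  have h1 := le_of_ge_of_eq v (key x hx) hr
  have h2 := key x⁻¹ (inv_ne_zero hx)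
  rw [map_inv₀] at h2
  have h3 := le_of_ge_of_eq v h2 (eq_inv v hr)
  rw [Padic.valuation_inv] at h3
  rw [hr]
  congr 1
  push_cast at h3
  linarith

open Classical in
noncomputable def absf {L : Type} [Field L] (v : AddValuation L (WithTop ℚ)) (hp : 1 < (p : ℝ)) :
    AbsoluteValue L ℝ where
  toFun x := if x = 0 then 0 else (p : ℝ) ^ (-(((v x).untopD 0 : ℚ) : ℝ))
  map_mul' x y := by
    by_cases hx : x = 0
    · simp [hx]
    by_cases hy : y = 0
    · simp [hy]
    obtain ⟨r, hr⟩ := exists_eq v hx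
    obtain ⟨s, hs⟩ := exists_eq v hy
    simp only [hx, hy, mul_eq_zero, or_self, if_false]
    rw [eq_mul v hr hs, hr, hs]
    simp only [WithTop.untopD_coe]
    rw [← Real.rpow_add (by linarith)]
    push_cast; ring_nf
  nonneg' x := by
    show 0 ≤ ite _ _ _
    split_ifs
    · rfl
    · positivity
  eq_zero' x := by
    show ite _ _ _ = _ ↔ _
    split_ifs with h
    · simp [h]
    · simp only [h, iff_false]
      have : 0 < (p : ℝ) := by linarith
      positivity
  add_le' x y := by
    show ite _ _ _ ≤ ite _ _ _ + ite _ _ _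
    have hp0 : 0 < (p : ℝ) := by linarith
    by_cases hx : x = 0
    · simp [hx]
    by_cases hy : y = 0
    · simp [hy]
    by_cases hxy : x + y = 0
    · rw [if_pos hxy]; positivity
    obtain ⟨r, hr⟩ := exists_eq v hx
    obtain ⟨s, hs⟩ := exists_eq v hy
    obtain ⟨t, ht⟩ := exists_eq v hxy
    rw [if_neg hx, if_neg hy, if_neg hxy, hr, hs, ht]
    simp only [WithTop.untopD_coe]
    have := v.map_add x y
    rw [hr, hs, ht, ← WithTop.coe_min, WithTop.coe_le_coe] at this
    rcases min_le_iff.1 this with h | h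
    · have h1 : (p : ℝ) ^ (-(t : ℝ)) ≤ (p : ℝ) ^ (-(r : ℝ)) :=
        Real.rpow_le_rpow_of_exponent_le hp.le (by simpa using h)
      have : 0 < (p : ℝ) ^ (-(s : ℝ)) := by positivity
      linarith
    · have h1 : (p : ℝ) ^ (-(t : ℝ)) ≤ (p : ℝ) ^ (-(s : ℝ)) :=
        Real.rpow_le_rpow_of_exponent_le hp.le (by simpa using h)
      have : 0 < (p : ℝ) ^ (-(r : ℝ)) := by positivity
      linarith

lemma gal_inv {K L : Type} [Field K] [Field L] [Algebra ℚ_[p] K] [FiniteDimensional ℚ_[p] K]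
    [Algebra K L] [FiniteDimensional K L] (v : AddValuation L (WithTop ℚ))
    (hpad : ∀ x : ℚ_[p], x ≠ 0 →
      v (algebraMap K L (algebraMap ℚ_[p] K x)) = ((x.valuation : ℚ) : WithTop ℚ))
    (σ : L ≃ₐ[K] L) (x : L) : v (σ x) = v x := by
  classical
  let _ : Algebra ℚ_[p] L := ((algebraMap K L).comp (algebraMap ℚ_[p] K)).toAlgebra
  have _ : IsScalarTower ℚ_[p] K L := IsScalarTower.of_algebraMap_eq' rfl
  have _ : FiniteDimensional ℚ_[p] L := FiniteDimensional.trans ℚ_[p] K L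
  have hp : 1 < (p : ℝ) := by exact_mod_cast (Fact.out : p.Prime).one_lt
  have hext : ∀ y : ℚ_[p], absf v hp (algebraMap ℚ_[p] L y) = ‖y‖ := by
    intro y
    show ite _ _ _ = _
    by_cases hy : y = 0
    · simp [hy]
    · have h0 : algebraMap ℚ_[p] L y ≠ 0 := (map_ne_zero _).2 hy
      have h1 : v (algebraMap ℚ_[p] L y) = ((y.valuation : ℚ) : WithTop ℚ) := hpad y hy
      rw [if_neg h0, h1, Padic.norm_eq_zpow_neg_valuation hy, WithTop.untopD_coe, ← Real.rpow_intCast]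
      simp
  have huniq := spectralNorm_unique_field_norm_ext hext
  by_cases hx : x = 0
  · simp [hx]
  have h := spectralNorm_eq_of_equiv (σ.restrictScalars ℚ_[p]) x
  rw [← huniq, ← huniq] at h
  change ite _ _ _ = ite _ _ _ at h
  have hσ : (σ.restrictScalars ℚ_[p]) x = σ x := rfl
  have hσ0 : σ x ≠ 0 := by simpa using hx
  rw [hσ, if_neg hx, if_neg hσ0] at h
  obtain ⟨r, hr⟩ := exists_eq v hx
  obtain ⟨s, hs⟩ := exists_eq v hσ0
  rw [hr, hs] at h ⊢
  simp only [WithTop.untopD_coe] at h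
  have hp0 : 0 < (p : ℝ) := by linarith
  have h2 := congrArg (Real.logb p) h
  rw [Real.logb_rpow hp0 (by linarith), Real.logb_rpow hp0 (by linarith)] at h2
  congr 1
  have : (s : ℝ) = r := by linarith
  exact_mod_cast this

end vals
end S6

set_option linter.unusedSectionVars false

namespace S6

section build

lemma exists_w {L : Type} [Field L] (v : AddValuation L (WithTop ℚ)) {e : ℕ} (he : 0 < e)
    (h : ∀ x : L, x ≠ 0 → ∃ m : ℤ, v x = (((m : ℚ) / e : ℚ) : WithTop ℚ)) :
    ∃ w : AddValuation L (WithTop ℤ), ∀ (x : L) (m : ℤ),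
      (w x = (m : WithTop ℤ) ↔ v x = (((m : ℚ) / e : ℚ) : WithTop ℚ)) := by
  have heq : (0 : ℚ) < e := by exact_mod_cast he
  have hfl : ∀ m : ℤ, ⌊(m : ℚ) / e * e⌋ = m := by
    intro m; rw [div_mul_cancel₀ _ heq.ne', Int.floor_intCast]
  have hmono : Monotone (fun q : ℚ => ⌊q * e⌋) := by
    intro a b hab; exact Int.floor_le_floor (mul_le_mul_of_nonneg_right hab heq.le)
  let F : L → WithTop ℤ := fun x => (v x).map (fun q : ℚ => ⌊q * e⌋)
  have hF : ∀ (x : L) (m : ℤ), v x = (((m : ℚ) / e : ℚ) : WithTop ℚ) → F x = (m : WithTop ℤ) := by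
    intro x m hm
    show (v x).map _ = _
    rw [hm, WithTop.map_coe, hfl]
  let w : AddValuation L (WithTop ℤ) := AddValuation.of F (by simp [F])
    (by have := hF 1 0 (by simp); simpa using this)
    (by
      intro x y
      have := v.map_add x y
      have hm : Monotone (WithTop.map (fun q : ℚ => ⌊q * e⌋)) := hmono.withTop_map
      show min ((v x).map _) ((v y).map _) ≤ (v (x + y)).map _
      rw [← hm.map_min]
      exact hm this)
    (by
      intro x y
      by_cases hx : x = 0
      · simp [F, hx]
      by_cases hy : y = 0
      · simp [F, hy]
      obtain ⟨m, hm⟩ := h x hx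
      obtain ⟨k, hk⟩ := h y hy
      rw [hF x m hm, hF y k hk, ← WithTop.coe_add]
      apply hF
      rw [eq_mul v hm hk]; congr 1; push_cast; ring)
  refine ⟨w, fun x m => ⟨fun hw => ?_, hF x m⟩⟩
  have hx : x ≠ 0 := ne_zero_of_eq w hw
  obtain ⟨k, hk⟩ := h x hx
  have h1 : w x = (k : WithTop ℤ) := hF x k hk
  rw [eq_unique w hw h1]; exact hk

variable {p : ℕ} {K L : Type} [Field K] [Field L] [Algebra K L] [FiniteDimensional K L] [IsGalois K L]

lemma exists_e (v : AddValuation L (WithTop ℚ)) (hinv : ∀ (σ : L ≃ₐ[K] L) (x : L), v (σ x) = v x)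
    (hint : ∀ k : K, k ≠ 0 → ∃ m : ℤ, v (algebraMap K L k) = ((m : ℚ) : WithTop ℚ))
    (hp : v (p : L) = ((1 : ℚ) : WithTop ℚ)) :
    ∃ (e : ℕ) (ϖ : L), 0 < e ∧ v ϖ = ((((1 : ℤ) : ℚ) / e : ℚ) : WithTop ℚ) ∧
      ∀ x : L, x ≠ 0 → ∃ m : ℤ, v x = (((m : ℚ) / e : ℚ) : WithTop ℚ) := by
  classical
  set N := Fintype.card (L ≃ₐ[K] L) with hN
  have hN0 : 0 < N := Fintype.card_pos
  have hNq : (0 : ℚ) < N := by exact_mod_cast hN0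
  have h1 : ∀ x : L, x ≠ 0 → ∃ m : ℤ, v x = (((m : ℚ) / N : ℚ) : WithTop ℚ) := by
    intro x hx
    obtain ⟨r, hr⟩ := exists_eq v hx
    have hprod := eq_prod v Finset.univ (fun σ : L ≃ₐ[K] L => σ x) (r := fun _ => r)
      (fun σ _ => by rw [hinv]; exact hr)
    rw [← Algebra.norm_eq_prod_automorphisms, Finset.sum_const, Finset.card_univ] at hprod
    have hk0 : Algebra.norm K x ≠ 0 := Algebra.norm_ne_zero_iff.2 hx
    obtain ⟨m, hm⟩ := hint _ hk0
    have := eq_unique v hm hprod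
    refine ⟨m, ?_⟩
    rw [hr]; congr 1
    rw [nsmul_eq_mul] at this
    field_simp
    linarith
  have hex : ∃ m : ℕ, 0 < m ∧ ∃ x : L, v x = (((m : ℚ) / N : ℚ) : WithTop ℚ) :=
    ⟨N, hN0, p, by rw [hp, div_self hNq.ne']⟩
  obtain ⟨hm0, ϖ, hϖ⟩ := Nat.find_spec hex
  set m0 := Nat.find hex with hm0def
  have hmin : ∀ m : ℕ, 0 < m → (∃ x : L, v x = (((m : ℚ) / N : ℚ) : WithTop ℚ)) → m0 ≤ m :=
    fun m h1 h2 => Nat.find_min' hex ⟨h1, h2⟩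
  have hϖ0 := ne_zero_of_eq v hϖ
  have hzp : ∀ t : ℤ, v (ϖ ^ t) = (((t * m0 : ℚ) / N : ℚ) : WithTop ℚ) := by
    intro t
    rcases Int.le_total 0 t with h | h
    · obtain ⟨s, rfl⟩ := Int.eq_ofNat_of_zero_le h
      rw [zpow_natCast, eq_pow v hϖ s]; congr 1; rw [nsmul_eq_mul]; push_cast; ring
    · obtain ⟨s, hs⟩ := Int.eq_ofNat_of_zero_le (Int.neg_nonneg_of_nonpos h)
      obtain rfl : t = -(s : ℤ) := by omega
      rw [zpow_neg, zpow_natCast, eq_inv v (eq_pow v hϖ s)]; congr 1; rw [nsmul_eq_mul]; push_cast; ring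
  have hdiv : ∀ x : L, ∀ m : ℤ, v x = (((m : ℚ) / N : ℚ) : WithTop ℚ) → (m0 : ℤ) ∣ m := by
    intro x m hm
    have hr0 : 0 ≤ m % m0 := Int.emod_nonneg _ (by omega)
    have hr1 : m % m0 < m0 := Int.emod_lt_of_pos _ (by omega)
    obtain ⟨r, hr⟩ := Int.eq_ofNat_of_zero_le hr0
    by_contra hnd
    have hr2 : m % m0 ≠ 0 := fun h => hnd (Int.dvd_of_emod_eq_zero h)
    have := hmin r (by omega) ⟨x * ϖ ^ (-(m / m0)), by
      rw [eq_mul v hm (hzp _)]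
      congr 1
      rw [← add_div]; congr 1
      have h3 := Int.mul_ediv_add_emod m m0
      have h4 : m - (m / m0) * m0 = r := by rw [← hr]; linarith
      have h5 : ((m - (m / m0) * m0 : ℤ) : ℚ) = r := by exact_mod_cast h4
      rw [← h5]; push_cast; ring⟩
    omega
  have hpN : v (p : L) = ((((N : ℤ) : ℚ) / N : ℚ) : WithTop ℚ) := by
    rw [hp]; congr 1; push_cast; rw [div_self hNq.ne']
  obtain ⟨e, he⟩ := Int.natCast_dvd_natCast.1 (hdiv _ _ hpN)
  have he0 : 0 < e := Nat.pos_of_ne_zero (by rintro rfl; omega)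
  have hNe : (N : ℚ) = m0 * e := by exact_mod_cast he
  have hm0q : (m0 : ℚ) ≠ 0 := by exact_mod_cast hm0.ne'
  have heq : (e : ℚ) ≠ 0 := by exact_mod_cast he0.ne'
  refine ⟨e, ϖ, he0, ?_, ?_⟩
  · rw [hϖ, hNe]; congr 1; push_cast; field_simp
  · intro x hx
    obtain ⟨m, hm⟩ := h1 x hx
    obtain ⟨t, rfl⟩ := hdiv x m hm
    refine ⟨t, ?_⟩
    rw [hm, hNe]; congr 1; push_cast; field_simp

end build

section resid

lemma frob_period {p : ℕ} [Fact p.Prime] {k : Type} [CommRing k] [IsDomain k] [CharP k p] {x : k}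
    (φ : ZMod p →+* k) (hx : φ.IsIntegralElem x) (n : ℕ) : ∃ N, n ≤ N ∧ x ^ (p ^ N) = x := by
  let _ : Algebra (ZMod p) k := φ.toAlgebra
  have hx' : IsIntegral (ZMod p) x := hx
  have hfg := hx'.fg_adjoin_singleton
  have : Module.Finite (ZMod p) (Algebra.adjoin (ZMod p) {x}) := Module.Finite.iff_fg.2 hfg
  have : Finite (Algebra.adjoin (ZMod p) {x}) := Module.finite_of_finite (ZMod p)
  let y : Algebra.adjoin (ZMod p) {x} := ⟨x, Algebra.subset_adjoin rfl⟩
  let F : Algebra.adjoin (ZMod p) {x} → Algebra.adjoin (ZMod p) {x} := fun z => z ^ p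
  have hF : Function.Injective F := by
    intro a b hab
    have h1 : (a : k) ^ p = (b : k) ^ p := congrArg Subtype.val hab
    apply Subtype.ext
    exact frobenius_inj k p h1
  have hmem := hF.mem_periodicPts y
  obtain ⟨M, hM, hper⟩ := hmem
  have h2 := hper.mul_const n
  have hit : ∀ m, F^[m] y = y ^ (p ^ m) := by
    intro m
    induction m with
    | zero => simp
    | succ m ih => rw [Function.iterate_succ_apply', ih]; show (y ^ p ^ m) ^ p = _; rw [← pow_mul, ← pow_succ]
  refine ⟨M * n, Nat.le_mul_of_pos_left n hM, ?_⟩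
  have h3 : F^[M * n] y = y := h2
  rw [hit] at h3
  exact congrArg Subtype.val h3

end resid
end S6

set_option linter.unusedSectionVars false

namespace S6

section resid2

open Polynomial

/-- valuation subring -/
def OO {L : Type} [Field L] (w : AddValuation L (WithTop ℤ)) : Subring L where
  carrier := {x | ((0 : ℤ) : WithTop ℤ) ≤ w x}
  mul_mem' {a b} ha hb := by
    have := ge_mul w ha hb
    simpa using this
  one_mem' := by simp
  add_mem' {a b} ha hb := le_trans (le_min ha hb) (w.map_add a b)
  zero_mem' := by simp
  neg_mem' {a} ha := by simpa using ha

def II {L : Type} [Field L] (w : AddValuation L (WithTop ℤ)) : Ideal (OO w) where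
  carrier := {x | ((1 : ℤ) : WithTop ℤ) ≤ w (x : L)}
  add_mem' {a b} ha hb := le_trans (le_min ha hb) (w.map_add a b)
  zero_mem' := by simp
  smul_mem' a b hb := by
    have := ge_mul w a.2 hb
    simpa using this

lemma mem_II {L : Type} [Field L] (w : AddValuation L (WithTop ℤ)) (x : OO w) :
   x ∈ II w ↔ ((1 : ℤ) : WithTop ℤ) ≤ w (x : L) := Iff.rfl

lemma II_prime {L : Type} [Field L] (w : AddValuation L (WithTop ℤ)) : (II w).IsPrime := by
  constructor
  · intro h
    have : (1 : OO w) ∈ II w := by rw [h]; trivial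
    rw [mem_II] at this
    simp at this
    exact absurd this (by decide)
  · intro x y hxy
    simp only [mem_II] at *
    by_contra hcon
    push Not at hcon
    have key : ∀ z : OO w, w (z : L) < ((1 : ℤ) : WithTop ℤ) → w (z : L) = ((0 : ℤ) : WithTop ℤ) := by
      intro z hz
      have h0 : ((0 : ℤ) : WithTop ℤ) ≤ w (z : L) := z.2
      obtain ⟨m, hm⟩ := WithTop.ne_top_iff_exists.1 (ne_top_of_lt hz)
      rw [← hm] at hz h0 ⊢
      have h1 := WithTop.coe_lt_coe.1 hz
      have h2 := WithTop.coe_le_coe.1 h0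
      congr 1; omega
    have h1 := key x hcon.1
    have h2 := key y hcon.2
    have h3 := eq_mul w h1 h2
    rw [Subring.coe_mul, h3] at hxy
    exact absurd (WithTop.coe_le_coe.1 hxy) (by decide)

lemma exists_period {p : ℕ} [Fact p.Prime] {L : Type} [Field L] (w : AddValuation L (WithTop ℤ))
    (j : ℤ_[p] →+* L) (hj : ∀ z, ((0 : ℤ) : WithTop ℤ) ≤ w (j z))
    (hp1 : ((1 : ℤ) : WithTop ℤ) ≤ w (p : L)) (hp0 : (p : L) ≠ 0) (x : L) (hx : ((0 : ℤ) : WithTop ℤ) ≤ w x)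
    (f : ℤ_[p][X]) (hf0 : f ≠ 0) (hf : f.eval₂ j x = 0) (n : ℕ) :
    ∃ N, n ≤ N ∧ ((1 : ℤ) : WithTop ℤ) ≤ w (x ^ (p ^ N) - x) := by
  have hpr : p.Prime := Fact.out
  have := II_prime w
  set k := OO w ⧸ II w with hk
  have hpk : ((p : ℕ) : k) = 0 := by
    have : ((p : ℕ) : k) = Ideal.Quotient.mk (II w) (p : OO w) := by simp
    rw [this, Ideal.Quotient.eq_zero_iff_mem, mem_II]
    simpa using hp1
  have : CharP k p := (CharP.charP_iff_prime_eq_zero hpr).2 hpk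
  let j' : ℤ_[p] →+* OO w := j.codRestrict (OO w) hj
  let θ : ℤ_[p] →+* k := (Ideal.Quotient.mk (II w)).comp j'
  let φ : ZMod p →+* k := ZMod.castHom dvd_rfl k
  have hθ : θ = φ.comp PadicInt.toZMod := by
    ext z
    have h1 := PadicInt.toZMod_spec z
    rw [PadicInt.maximalIdeal_eq_span_p, Ideal.mem_span_singleton] at h1
    obtain ⟨y, hy⟩ := h1
    have h2 : z = ((PadicInt.toZMod z).val : ℤ_[p]) + p * y := by
      rw [← hy]
      rw [ZMod.cast_eq_val]; ring
    conv_lhs => rw [h2]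
    rw [map_add, map_mul, map_natCast, map_natCast, hpk, zero_mul, add_zero]
    simp [φ, ZMod.cast_eq_val]
  -- remove powers of p
  have hCp : ¬ IsUnit (C (p : ℤ_[p])) := by
    rw [Polynomial.isUnit_C]; exact PadicInt.p_nonunit
  obtain ⟨f1, hf1, hnd⟩ := (FiniteMultiplicity.of_not_isUnit hCp hf0).exists_eq_pow_mul_and_not_dvd
  have hf1x : f1.eval₂ j x = 0 := by
    rw [hf1, eval₂_mul, eval₂_pow, eval₂_C, map_natCast] at hf
    exact (mul_eq_zero.1 hf).resolve_left (pow_ne_zero _ hp0)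
  set q := f1.map PadicInt.toZMod with hq
  have hq0 : q ≠ 0 := by
    intro h0
    apply hnd
    rw [Polynomial.C_dvd_iff_dvd_coeff]
    intro i
    have : PadicInt.toZMod (f1.coeff i) = 0 := by
      rw [← Polynomial.coeff_map, ← hq, h0, coeff_zero]
    have : f1.coeff i ∈ RingHom.ker (PadicInt.toZMod (p := p)) := this
    rw [PadicInt.ker_toZMod, PadicInt.maximalIdeal_eq_span_p, Ideal.mem_span_singleton] at this
    exact this
  let X0 : OO w := ⟨x, hx⟩
  have hev : q.eval₂ φ (Ideal.Quotient.mk (II w) X0) = 0 := by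
    rw [hq, eval₂_map, ← hθ]
    have h1 : (Ideal.Quotient.mk (II w)) (f1.eval₂ j' X0) = f1.eval₂ θ (Ideal.Quotient.mk (II w) X0) :=
      Polynomial.hom_eval₂ f1 j' (Ideal.Quotient.mk (II w)) X0
    rw [← h1]
    have h2 : f1.eval₂ j' X0 = 0 := by
      apply Subtype.ext
      have := Polynomial.hom_eval₂ f1 j' (OO w).subtype X0
      exact this.trans hf1x
    rw [h2, map_zero]
  have hint : φ.IsIntegralElem (Ideal.Quotient.mk (II w) X0) := by
    refine ⟨q * C (q.leadingCoeff⁻¹), monic_mul_leadingCoeff_inv hq0, ?_⟩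
    rw [eval₂_mul, hev, zero_mul]
  obtain ⟨N, hN, hN2⟩ := frob_period φ hint n
  refine ⟨N, hN, ?_⟩
  rw [← map_pow, Ideal.Quotient.eq, mem_II] at hN2
  exact hN2

end resid2
end S6

set_option linter.unusedSectionVars false

namespace S6

section resid3

variable {p n : ℕ} {K L : Type} [Field K] [Field L] [Algebra K L] [FiniteDimensional K L] [IsGalois K L]

open Classical in
lemma res_K (hpr : p.Prime) (w : AddValuation L (WithTop ℤ))
    (h0 : ∀ (σ : L ≃ₐ[K] L) (x : L), ((0 : ℤ) : WithTop ℤ) ≤ w x → ((1 : ℤ) : WithTop ℤ) ≤ w (σ x - x))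
    (hab : ∀ σ τ : L ≃ₐ[K] L, σ * τ = τ * σ) (g : L ≃ₐ[K] L) (hg : orderOf g = p ^ n)
    (Δ : Subgroup (L ≃ₐ[K] L)) (hΔ : Nat.card ↥Δ = p - 1)
    (hcard : Nat.card (L ≃ₐ[K] L) = (p - 1) * p ^ n)
    (hp1 : ((1 : ℤ) : WithTop ℤ) ≤ w (p : L))
    (hper : ∀ x : L, ((0 : ℤ) : WithTop ℤ) ≤ w x →
      ∃ N, n ≤ N ∧ ((1 : ℤ) : WithTop ℤ) ≤ w (x ^ (p ^ N) - x))
    (x : L) (hx : ((0 : ℤ) : WithTop ℤ) ≤ w x) :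
    ∃ k : K, ((1 : ℤ) : WithTop ℤ) ≤ w (x - algebraMap K L k) := by
  have hp2 := hpr.two_le
  replace hx : x ∈ OO w := hx
  have hO : ∀ (σ : L ≃ₐ[K] L) (x : L), x ∈ OO w → σ x ∈ OO w := by
    intro σ x hx
    have h1 : σ x - x ∈ OO w := le_trans (WithTop.coe_le_coe.2 (by norm_num)) (h0 σ x hx)
    have := (OO w).add_mem h1 hx
    simpa using this
  set q := Ideal.Quotient.mk (II w) with hq
  have hqs : ∀ (σ : L ≃ₐ[K] L) (y : L) (hy : y ∈ OO w) , q ⟨σ y, hO σ y hy⟩ = q ⟨y, hy⟩ := by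
    intro σ y hy
    rw [Ideal.Quotient.eq, mem_II]
    exact h0 σ y hy
  have hqp : q (p : OO w) = 0 := by
    rw [Ideal.Quotient.eq_zero_iff_mem, mem_II]; simpa using hp1
  set H := Subgroup.zpowers g with hH
  have hHc : Fintype.card H = p ^ n := by rw [← Nat.card_eq_fintype_card, Nat.card_zpowers, hg]
  set Z : OO w := ∏ h : H, ⟨(h : L ≃ₐ[K] L) x, hO _ _ hx⟩ with hZ
  have hqZ : q Z = q ⟨x, hx⟩ ^ (p ^ n) := by
    rw [hZ, map_prod, Finset.prod_congr rfl (fun (h : H) _ => hqs (h : L ≃ₐ[K] L) x hx), Finset.prod_const,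
      Finset.card_univ, hHc]
  have hZv : (Z : L) = ∏ h : H, (h : L ≃ₐ[K] L) x := by
    rw [hZ]; simp
  set T : OO w := ∑ ρ : Δ, ⟨(ρ : L ≃ₐ[K] L) Z, hO _ _ Z.2⟩ with hT
  have hqT : q T = - q Z := by
    rw [hT, map_sum, Finset.sum_congr rfl (fun (ρ : Δ) _ => hqs (ρ : L ≃ₐ[K] L) Z Z.2), Finset.sum_const,
      Finset.card_univ, ← Nat.card_eq_fintype_card, hΔ, nsmul_eq_mul, Nat.cast_sub (by omega)]
    have : ((p : ℕ) : OO w ⧸ II w) = 0 := by rw [← hqp]; simp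
    rw [this]; simp
  have hTv : (T : L) = ∑ ρ : Δ, (ρ : L ≃ₐ[K] L) (Z : L) := by
    rw [hT]; simp
  have hZfix : ∀ h : H, (h : L ≃ₐ[K] L) (Z : L) = Z := by
    intro h
    rw [hZv, map_prod]
    exact Fintype.prod_equiv (Equiv.mulLeft h) _ _ (fun x => rfl)
  have hc : Subgroup.IsComplement' Δ H := by
    apply Subgroup.isComplement'_of_coprime
    · rw [hΔ, Nat.card_zpowers, hg, hcard]
    · rw [hΔ, Nat.card_zpowers, hg]
      refine ((hpr.coprime_iff_not_dvd).2 ?_).symm.pow_right n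
      intro h; have := Nat.le_of_dvd (by omega) h; omega
  have hfix : ∀ σ : L ≃ₐ[K] L, σ (T : L) = T := by
    intro σ
    obtain ⟨⟨ρ, h⟩, rfl⟩ := (Subgroup.isComplement'_def.1 hc).2 σ
    rw [hTv, map_sum]
    refine Fintype.sum_equiv (Equiv.mulLeft ρ) _ _ (fun τ => ?_)
    show ((ρ : L ≃ₐ[K] L) * h) ((τ : L ≃ₐ[K] L) Z) = ((ρ * τ : Δ) : L ≃ₐ[K] L) Z
    have h1 : ((ρ : L ≃ₐ[K] L) * h) ((τ : L ≃ₐ[K] L) Z) = ((ρ : L ≃ₐ[K] L) * (h * τ)) Z := rfl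
    rw [h1, hab h τ]
    show (ρ : L ≃ₐ[K] L) ((τ : L ≃ₐ[K] L) ((h : L ≃ₐ[K] L) Z)) = _
    rw [hZfix]; rfl
  obtain ⟨k, hk⟩ := (IsGalois.mem_range_algebraMap_iff_fixed (F := K) (E := L) (T : L)).2 hfix
  obtain ⟨N, hN, hN2⟩ := hper x hx
  refine ⟨(-k) ^ (p ^ (N - n)), ?_⟩
  have e1 : q ⟨x, hx⟩ ^ (p ^ N) = q ⟨x, hx⟩ := by
    rw [← map_pow, Ideal.Quotient.eq, mem_II]; exact hN2
  have e2 : q ((-T) ^ (p ^ (N - n))) = q ⟨x, hx⟩ := by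
    rw [map_pow, map_neg, hqT, neg_neg, hqZ, ← pow_mul, ← pow_add, Nat.add_sub_cancel' hN, e1]
  have e3 := Ideal.Quotient.eq.1 e2.symm
  rw [mem_II] at e3
  rw [map_pow, map_neg, hk]
  exact e3

end resid3
end S6

set_option linter.unusedSectionVars false

namespace S6

section herb

lemma herb (c : ℤ → ℕ) (hc : Antitone c) (hpos : ∀ i, 0 < c i) (φ : ℝ → ℝ)
    (hφ : ∀ u, φ u = ∫ t in (0:ℝ)..u, (c ⌈t⌉ : ℝ) / (c 0 : ℝ)) :
    Function.invFun φ 0 = 0 ∧ (c 0 : ℝ) ≤ Function.invFun φ 1 * c 1 := by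
  have h0 : (0 : ℝ) < c 0 := by exact_mod_cast hpos 0
  set f : ℝ → ℝ := fun t => (c ⌈t⌉ : ℝ) / (c 0 : ℝ) with hf
  have hanti : Antitone f := by
    intro a b hab
    have : c ⌈b⌉ ≤ c ⌈a⌉ := hc (Int.ceil_mono hab)
    simp only [hf]
    gcongr
  have hint : ∀ a b, IntervalIntegrable f MeasureTheory.volume a b :=
    fun a b => hanti.intervalIntegrable
  have hlow : ∀ a b, a ≤ b → (b - a) / c 0 ≤ φ b - φ a := by
    intro a b hab
    have h1 : φ b - φ a = ∫ t in a..b, f t := by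
      rw [hφ, hφ, intervalIntegral.integral_interval_sub_left (hint _ _) (hint _ _)]
    rw [h1]
    have h2 : ∫ t in a..b, (1 / c 0 : ℝ) = (b - a) / c 0 := by
      rw [intervalIntegral.integral_const, smul_eq_mul]; ring
    rw [← h2]
    apply intervalIntegral.integral_mono_on hab (by simp) (hint _ _)
    intro t _
    have : (1 : ℝ) ≤ c ⌈t⌉ := by exact_mod_cast hpos _
    simp only [hf]
    gcongr
  have hmono : StrictMono φ := by
    intro a b hab
    have := hlow a b hab.le
    have : 0 < (b - a) / c 0 := div_pos (by linarith) h0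
    linarith
  have hφ0 : φ 0 = 0 := by rw [hφ]; simp
  have hcont : Continuous φ := by
    have : φ = fun u => ∫ t in (0:ℝ)..u, f t := funext hφ
    rw [this]
    exact intervalIntegral.continuous_primitive hint 0
  constructor
  · have := Function.leftInverse_invFun hmono.injective 0
    rwa [hφ0] at this
  · have hex : ∃ u, φ u = 1 := by
      have h1 : 1 ≤ φ (c 0) := by
        have := hlow 0 (c 0) h0.le
        rw [hφ0, sub_zero, sub_zero, div_self h0.ne'] at this
        exact this
      obtain ⟨u, -, hu⟩ := intermediate_value_Icc h0.le hcont.continuousOn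
        (show (1 : ℝ) ∈ Set.Icc (φ 0) (φ (c 0)) from ⟨by rw [hφ0]; norm_num, h1⟩)
      exact ⟨u, hu⟩
    have hu := Function.invFun_eq hex
    set u := Function.invFun φ 1
    have hu0 : 0 < u := by
      rw [← hmono.lt_iff_lt, hφ0, hu]; norm_num
    have hup : φ u ≤ u * (c 1 / c 0) := by
      rw [hφ]
      have h2 : ∫ t in (0:ℝ)..u, (c 1 / c 0 : ℝ) = u * (c 1 / c 0) := by
        rw [intervalIntegral.integral_const, smul_eq_mul]; ring
      rw [← h2]
      apply intervalIntegral.integral_mono_on_of_le_Ioo hu0.le (hint _ _) (by simp)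
      intro t ht
      have : c ⌈t⌉ ≤ c 1 := hc (by have := Int.ceil_pos.2 ht.1; omega)
      show (c ⌈t⌉ : ℝ) / (c 0 : ℝ) ≤ c 1 / c 0
      gcongr
    rw [hu, mul_div_assoc', le_div_iff₀ h0] at hup
    linarith

end herb
end S6

set_option linter.unusedSectionVars false

namespace S6

section link

variable {p : ℕ} {A : Type} [Field A] {vd : PadicValData A p} {L : Type} [Field L] {emb : L →+* A}
  {w : AddValuation L (WithTop ℤ)} {e : ℕ} {ϖ : L}

lemma link_ge (he : 0 < e) (hw : ∀ (x : L) (m : ℤ),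
      (w x = (m : WithTop ℤ) ↔ vd.v (emb x) = (((m : ℚ) / e : ℚ) : WithTop ℚ))) (x : L) :
    0 ≤ vd.v (emb x) ↔ ((0 : ℤ) : WithTop ℤ) ≤ w x := by
  by_cases hx : x = 0
  · subst hx
    have : vd.v (emb 0) = ⊤ := (vd.v_top_iff _).2 (map_zero emb)
    rw [this]; simp
  · obtain ⟨m, hm⟩ := exists_eq w hx
    rw [hm, (hw x m).1 hm, WithTop.coe_le_coe, ← WithTop.coe_zero, WithTop.coe_le_coe]
    have : (0 : ℚ) < e := by exact_mod_cast he
    rw [le_div_iff₀ this, zero_mul]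
    exact_mod_cast Iff.rfl

lemma link_gt (he : 0 < e) (hw : ∀ (x : L) (m : ℤ),
      (w x = (m : WithTop ℤ) ↔ vd.v (emb x) = (((m : ℚ) / e : ℚ) : WithTop ℚ))) (x : L) :
    0 < vd.v (emb x) ↔ ((1 : ℤ) : WithTop ℤ) ≤ w x := by
  by_cases hx : x = 0
  · subst hx
    have : vd.v (emb 0) = ⊤ := (vd.v_top_iff _).2 (map_zero emb)
    rw [this]; simp
  · obtain ⟨m, hm⟩ := exists_eq w hx
    rw [hm, (hw x m).1 hm, WithTop.coe_le_coe, ← WithTop.coe_zero, WithTop.coe_lt_coe]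
    have : (0 : ℚ) < e := by exact_mod_cast he
    rw [lt_div_iff₀ this, zero_mul]
    have h2 : (0 : ℚ) < m ↔ 0 < m := by exact_mod_cast Iff.rfl
    rw [h2]; omega

lemma link_pow (he : 0 < e) (hw : ∀ (x : L) (m : ℤ),
      (w x = (m : WithTop ℤ) ↔ vd.v (emb x) = (((m : ℚ) / e : ℚ) : WithTop ℚ)))
    (hϖ : w ϖ = ((1 : ℤ) : WithTop ℤ)) (j : ℕ) (y : L) :
    InMaxIdealPow vd emb j (emb y) ↔ ((j : ℤ) : WithTop ℤ) ≤ w y := by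
  constructor
  · rintro ⟨u, s, hu, hs, hy⟩
    rw [← map_prod, ← map_mul] at hy
    rw [emb.injective hy]
    have h1 := ge_prod w Finset.univ s (r := fun _ => (1 : ℤ)) (fun k _ => (link_gt he hw _).1 (hs k))
    have h2 := ge_mul w ((link_ge he hw _).1 hu) h1
    simpa using h2
  · intro hy
    have h1 := eq_pow w hϖ j
    have h0 := ne_zero_of_eq w h1
    refine ⟨y / ϖ ^ j, fun _ => ϖ, ?_, fun _ => (link_gt he hw _).2 hϖ.ge, ?_⟩
    · rw [link_ge he hw]
      have := ge_div w hy h1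
      simpa using this
    · rw [← map_prod, ← map_mul]; simp
      rw [← map_pow, div_mul_cancel₀ _ ((map_ne_zero emb).2 h0)]

variable {K : Type} [Field K] [Algebra K L]

lemma mem_R (he : 0 < e) (hw : ∀ (x : L) (m : ℤ),
      (w x = (m : WithTop ℤ) ↔ vd.v (emb x) = (((m : ℚ) / e : ℚ) : WithTop ℚ)))
    (hϖ : w ϖ = ((1 : ℤ) : WithTop ℤ)) (i : ℤ) (σ : L ≃ₐ[K] L) :
    σ ∈ lowerRamSet vd K L emb i ↔ ∀ x : L, ((0 : ℤ) : WithTop ℤ) ≤ w x →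
      (((i + 1).toNat : ℤ) : WithTop ℤ) ≤ w (σ x - x) := by
  unfold lowerRamSet
  simp only [Set.mem_ofPred_eq]
  refine forall_congr' fun x => ?_
  rw [link_ge he hw, ← map_sub, link_pow he hw hϖ]

lemma R_anti (he : 0 < e) (hw : ∀ (x : L) (m : ℤ),
      (w x = (m : WithTop ℤ) ↔ vd.v (emb x) = (((m : ℚ) / e : ℚ) : WithTop ℚ)))
    (hϖ : w ϖ = ((1 : ℤ) : WithTop ℤ)) : Antitone (lowerRamSet vd K L emb) := by
  intro i j hij σ hσ
  rw [mem_R he hw hϖ] at *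
  intro x hx
  refine le_trans (WithTop.coe_le_coe.2 ?_) (hσ x hx)
  omega

lemma R_one (he : 0 < e) (hw : ∀ (x : L) (m : ℤ),
      (w x = (m : WithTop ℤ) ↔ vd.v (emb x) = (((m : ℚ) / e : ℚ) : WithTop ℚ)))
    (hϖ : w ϖ = ((1 : ℤ) : WithTop ℤ)) (i : ℤ) : (1 : L ≃ₐ[K] L) ∈ lowerRamSet vd K L emb i := by
  rw [mem_R he hw hϖ]; intro x _; simp

lemma R_mul (he : 0 < e) (hw : ∀ (x : L) (m : ℤ),
      (w x = (m : WithTop ℤ) ↔ vd.v (emb x) = (((m : ℚ) / e : ℚ) : WithTop ℚ)))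
    (hϖ : w ϖ = ((1 : ℤ) : WithTop ℤ)) (hinv : ∀ (σ : L ≃ₐ[K] L) (x : L), w (σ x) = w x)
    (i : ℤ) {σ τ : L ≃ₐ[K] L} (hσ : σ ∈ lowerRamSet vd K L emb i)
    (hτ : τ ∈ lowerRamSet vd K L emb i) : σ * τ ∈ lowerRamSet vd K L emb i := by
  rw [mem_R he hw hϖ] at *
  intro x hx
  have h1 := hσ (τ x) (by rw [hinv]; exact hx)
  have h2 := hτ x hx
  have h3 := le_trans (le_min h1 h2) (w.map_add _ _)
  have h4 : (σ * τ) x = σ (τ x) := rfl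
  rw [h4]
  simpa using h3

lemma R_inv (he : 0 < e) (hw : ∀ (x : L) (m : ℤ),
      (w x = (m : WithTop ℤ) ↔ vd.v (emb x) = (((m : ℚ) / e : ℚ) : WithTop ℚ)))
    (hϖ : w ϖ = ((1 : ℤ) : WithTop ℤ)) (hinv : ∀ (σ : L ≃ₐ[K] L) (x : L), w (σ x) = w x)
    (i : ℤ) {σ : L ≃ₐ[K] L} (hσ : σ ∈ lowerRamSet vd K L emb i) :
    σ⁻¹ ∈ lowerRamSet vd K L emb i := by
  rw [mem_R he hw hϖ] at *
  intro x hx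
  have h1 := hσ (σ⁻¹ x) (by rw [hinv]; exact hx)
  have h2 : σ (σ⁻¹ x) = x := by rw [← AlgEquiv.mul_apply, mul_inv_cancel]; rfl
  rw [h2, w.map_sub_swap] at h1
  exact h1

/-- lower ramification group -/
def RS (he : 0 < e) (hw : ∀ (x : L) (m : ℤ),
      (w x = (m : WithTop ℤ) ↔ vd.v (emb x) = (((m : ℚ) / e : ℚ) : WithTop ℚ)))
    (hϖ : w ϖ = ((1 : ℤ) : WithTop ℤ)) (hinv : ∀ (σ : L ≃ₐ[K] L) (x : L), w (σ x) = w x)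
    (i : ℤ) : Subgroup (L ≃ₐ[K] L) where
  carrier := lowerRamSet vd K L emb i
  mul_mem' := R_mul he hw hϖ hinv i
  one_mem' := R_one he hw hϖ i
  inv_mem' := R_inv he hw hϖ hinv i

variable [FiniteDimensional K L]

/-- step A : the shape of the upper numbering groups -/
lemma stepA [Fact p.Prime] (he : 0 < e) (hw : ∀ (x : L) (m : ℤ),
      (w x = (m : WithTop ℤ) ↔ vd.v (emb x) = (((m : ℚ) / e : ℚ) : WithTop ℚ)))
    (hϖ : w ϖ = ((1 : ℤ) : WithTop ℤ)) (hinv : ∀ (σ : L ≃ₐ[K] L) (x : L), w (σ x) = w x)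
    {n : ℕ} (hram : RamCond vd K L emb n) :
    lowerRamSet vd K L emb 0 = Set.univ ∧
    Nat.card ↥(upperRamSet vd K L emb 1) = p ^ n ∧
    Nat.card (L ≃ₐ[K] L) = (p - 1) * p ^ n ∧
    upperRamSet vd K L emb 1 = lowerRamSet vd K L emb ⌈herbrandPsi vd K L emb 1⌉ ∧
    ((Nat.card ↥(lowerRamSet vd K L emb 0) : ℝ) ≤
      herbrandPsi vd K L emb 1 * Nat.card ↥(lowerRamSet vd K L emb 1)) := by
  obtain ⟨-, h0, -, h01, hstep, hlast⟩ := hram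
  have hH := herb (fun i => Nat.card ↥(lowerRamSet vd K L emb i))
    (fun i j hij => Nat.card_mono (Set.toFinite _) (R_anti he hw hϖ hij))
    (fun i => by
      have : Nonempty ↥(lowerRamSet vd K L emb i) := ⟨⟨1, R_one he hw hϖ i⟩⟩
      exact Nat.card_pos) (herbrandPhi vd K L emb) (fun u => rfl)
  have hup0 : upperRamSet vd K L emb 0 = lowerRamSet vd K L emb 0 := by
    unfold upperRamSet herbrandPsi
    rw [Int.cast_zero, hH.1, Int.ceil_zero]
  have hj : ∀ j : ℕ, j ≤ n → Nat.card ↥(upperRamSet vd K L emb ((n + 1 - j : ℕ) : ℤ)) = p ^ j := by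
    intro j
    induction j with
    | zero => intro _; rw [Nat.sub_zero, Nat.cast_add, Nat.cast_one, hlast]; simp
    | succ j ih =>
      intro hj
      have := hstep (n + 1 - (j + 1)) (by omega) (by omega)
      rw [this]
      have h2 : ((n + 1 - (j + 1) : ℕ) : ℤ) + 1 = ((n + 1 - j : ℕ) : ℤ) := by omega
      rw [h2, ih (by omega), pow_succ, mul_comm]
  have h1 := hj n le_rfl
  have h2 : ((n + 1 - n : ℕ) : ℤ) = 1 := by omega
  rw [h2] at h1
  refine ⟨by rw [← hup0, h0], h1, ?_, ?_, ?_⟩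
  · rw [h1, h0] at h01
    rw [← h01, Nat.card_congr (Equiv.Set.univ _)]
  · unfold upperRamSet; rw [Int.cast_one]
  · exact hH.2

end link
end S6

set_option linter.unusedSectionVars false

namespace S6

section mk

variable {p : ℕ} {A : Type} [Field A] {vd : PadicValData A p} {L : Type} [Field L] {emb : L →+* A}
  {w : AddValuation L (WithTop ℤ)} {e : ℕ} {ϖ : L}

variable {K : Type} [Field K] [Algebra K L] [FiniteDimensional K L] [IsGalois K L]

lemma mkGal [Fact p.Prime] (hp3 : 3 ≤ p) (he : 0 < e) (hw : ∀ (x : L) (m : ℤ),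
      (w x = (m : WithTop ℤ) ↔ vd.v (emb x) = (((m : ℚ) / e : ℚ) : WithTop ℚ)))
    (hϖ : w ϖ = ((1 : ℤ) : WithTop ℤ)) (hinv : ∀ (σ : L ≃ₐ[K] L) (x : L), w (σ x) = w x)
    {n : ℕ} (hn : 1 ≤ n) (hram : RamCond vd K L emb n)
    (hab : ∀ σ τ : L ≃ₐ[K] L, σ * τ = τ * σ)
    (hwp : w (p : L) = ((e : ℤ) : WithTop ℤ))
    (hK : ∀ k : K, k ≠ 0 → ∃ m : ℤ, w (algebraMap K L k) = ((e * m : ℤ) : WithTop ℤ))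
    (hper : ∀ x : L, ((0 : ℤ) : WithTop ℤ) ≤ w x →
      ∃ N, n ≤ N ∧ ((1 : ℤ) : WithTop ℤ) ≤ w (x ^ (p ^ N) - x))
    (g : L ≃ₐ[K] L) (hg : g ∈ upperRamSet vd K L emb 1)
    (hcyc : ∀ h ∈ upperRamSet vd K L emb 1, ∃ k : ℕ, h = g ^ k)
    (Δ : Subgroup (L ≃ₐ[K] L)) (hΔ : Nat.card ↥Δ = p - 1) :
    Gal p n K L w ϖ e g Δ := by
  have hpr : p.Prime := Fact.out
  obtain ⟨hR0, hc1, hcG, hup, hlow⟩ := stepA he hw hϖ hinv hram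
  set u := herbrandPsi vd K L emb 1 with hu
  have hcarr : upperRamSet vd K L emb 1 = (Subgroup.zpowers g : Set (L ≃ₐ[K] L)) := by
    ext h
    constructor
    · intro hh
      obtain ⟨k, rfl⟩ := hcyc h hh
      exact Subgroup.pow_mem _ (Subgroup.mem_zpowers g) k
    · intro hh
      rw [hup] at hg ⊢
      have h1 : g ∈ RS he hw hϖ hinv ⌈u⌉ := hg
      exact (Subgroup.zpowers_le.2 h1) hh
  have hog : orderOf g = p ^ n := by
    rw [← Nat.card_zpowers, ← hc1, hcarr]; rfl
  have h0 : ∀ (σ : L ≃ₐ[K] L) (x : L), ((0 : ℤ) : WithTop ℤ) ≤ w x →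
      ((1 : ℤ) : WithTop ℤ) ≤ w (σ x - x) := by
    intro σ x hx
    have : σ ∈ lowerRamSet vd K L emb 0 := by rw [hR0]; trivial
    rw [mem_R he hw hϖ] at this
    simpa using this x hx
  have hC : Core p K L w ϖ e :=
    { prime := hpr, inv := hinv, unif := hϖ, valK := hK, valp := hwp, epos := he
      res := res_K hpr w h0 hab g hog Δ hΔ hcG (by rw [hwp]; exact WithTop.coe_le_coe.2 (by omega)) hper }
  have hc0R : (Nat.card ↥(lowerRamSet vd K L emb 0)) = (p - 1) * p ^ n := by
    rw [hR0, Nat.card_congr (Equiv.Set.univ _), hcG]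
  have hc0pos : 0 < (p - 1) * p ^ n := Nat.mul_pos (by omega) (by positivity)
  have hlc : (Nat.card ↥(lowerRamSet vd K L emb 1)) ≤ Nat.card ↥(lowerRamSet vd K L emb 0) :=
    Nat.card_mono (Set.toFinite _) (R_anti he hw hϖ (by norm_num))
  have hupos : 0 < u := by
    by_contra hcon
    push Not at hcon
    have h1 : (0 : ℝ) < (Nat.card ↥(lowerRamSet vd K L emb 0) : ℝ) := by
      rw [hc0R]; exact_mod_cast hc0pos
    have h2 : (0 : ℝ) ≤ (Nat.card ↥(lowerRamSet vd K L emb 1) : ℝ) := by positivity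
    nlinarith
  have hg1 : g ∈ lowerRamSet vd K L emb 1 := by
    rw [hup] at hg
    exact R_anti he hw hϖ (by have := Int.ceil_pos.2 hupos; omega) hg
  have hcp : Subgroup.IsComplement' Δ (Subgroup.zpowers g) := by
    apply Subgroup.isComplement'_of_coprime
    · rw [hΔ, Nat.card_zpowers, hog, hcG]
    · rw [hΔ, Nat.card_zpowers, hog]
      refine ((hpr.coprime_iff_not_dvd).2 ?_).symm.pow_right n
      intro h; have := Nat.le_of_dvd (by omega) h; omega
  have hsub : lowerRamSet vd K L emb 1 ⊆ (Subgroup.zpowers g : Set (L ≃ₐ[K] L)) := by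
    intro σ hσ
    obtain ⟨⟨ρ, h⟩, rfl⟩ := (Subgroup.isComplement'_def.1 hcp).2 σ
    have hσ' : (ρ : L ≃ₐ[K] L) * h ∈ RS he hw hϖ hinv 1 := hσ
    have hh : (h : L ≃ₐ[K] L) ∈ RS he hw hϖ hinv 1 :=
      (Subgroup.zpowers_le.2 (show g ∈ RS he hw hϖ hinv 1 from hg1)) h.2
    have hρ : (ρ : L ≃ₐ[K] L) ∈ lowerRamSet vd K L emb 1 := (Subgroup.mul_mem_cancel_right _ hh).1 hσ'
    rw [mem_R he hw hϖ] at hρ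
    have h2 := hρ ϖ (by rw [hϖ]; exact WithTop.coe_le_coe.2 (by norm_num))
    have h3 : (ρ : L ≃ₐ[K] L) = 1 := by
      refine hC.tame (m := p - 1) (by simpa using h2) ?_ ?_
      · intro h; have := Nat.le_of_dvd (by omega) h; omega
      · have := pow_card_eq_one' (x := (⟨ρ.1, ρ.2⟩ : Δ))
        rw [hΔ] at this
        exact congrArg Subtype.val this
    show (ρ : L ≃ₐ[K] L) * h ∈ _
    rw [h3, one_mul]; exact h.2
  have hc1R : (Nat.card ↥(lowerRamSet vd K L emb 1)) ≤ p ^ n := by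
    have := Nat.card_mono (Set.toFinite _) hsub
    refine this.trans (le_of_eq ?_)
    rw [← hc1, hcarr]
  have hup1 : ((p - 1 : ℕ) : ℝ) ≤ u := by
    have h1 : ((Nat.card ↥(lowerRamSet vd K L emb 1) : ℕ) : ℝ) ≤ (p : ℝ) ^ n := by exact_mod_cast hc1R
    have h2 : (((p - 1) * p ^ n : ℕ) : ℝ) ≤ u * (p : ℝ) ^ n := by
      rw [← hc0R]; exact hlow.trans (mul_le_mul_of_nonneg_left h1 hupos.le)
    have hp0' : (0 : ℝ) < p := by exact_mod_cast hpr.pos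
    have hpp : (0 : ℝ) < (p : ℝ) ^ n := by positivity
    rw [Nat.cast_mul, Nat.cast_pow] at h2
    exact le_of_mul_le_mul_right h2 hpp
  have hceil : ((p - 1 : ℕ) : ℤ) ≤ ⌈u⌉ := by
    have : (((p - 1 : ℕ) : ℤ) : ℝ) ≤ (⌈u⌉ : ℝ) := le_trans (by exact_mod_cast hup1) (Int.le_ceil u)
    exact_mod_cast this
  refine ⟨hC, hp3, hn, by rw [← hC.card_aut, hcG], hab, hog, ?_, hΔ⟩
  rw [hup] at hg
  have := R_anti he hw hϖ hceil hg
  rw [mem_R he hw hϖ] at this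
  have h2 := this ϖ (by rw [hϖ]; exact WithTop.coe_le_coe.2 (by norm_num))
  refine le_trans (WithTop.coe_le_coe.2 ?_) h2
  omega

end mk
end S6

set_option linter.unusedSectionVars false

namespace S6

section rou

open Polynomial

lemma teich {p : ℕ} [Fact p.Prime] (a : (ZMod p)ˣ) :
    ∃ z : ℤ_[p], z ^ (p - 1) = 1 ∧ PadicInt.toZMod z = a := by
  have hpr : p.Prime := Fact.out
  have hp2 := hpr.two_le
  set i : ℕ := (a : ZMod p).val with hi
  have hia : ((i : ℕ) : ZMod p) = a := ZMod.natCast_zmod_val _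
  have hz : ∀ y : ℤ_[p], ‖y‖ < 1 ↔ PadicInt.toZMod y = 0 := by
    intro y
    rw [PadicInt.norm_lt_one_iff_dvd, ← Ideal.mem_span_singleton, ← PadicInt.maximalIdeal_eq_span_p,
      ← PadicInt.ker_toZMod, RingHom.mem_ker]
  have hn1 : ∀ y : ℤ_[p], PadicInt.toZMod y ≠ 0 → ‖y‖ = 1 := by
    intro y hy
    have := PadicInt.norm_le_one y
    by_contra hne
    exact hy ((hz y).1 (lt_of_le_of_ne this hne))
  set F : ℤ_[p][X] := X ^ (p - 1) - 1 with hF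
  have hd : F.derivative.aeval (i : ℤ_[p]) = ((p - 1 : ℕ) : ℤ_[p]) * (i : ℤ_[p]) ^ (p - 1 - 1) := by
    simp [hF, derivative_X_pow]
  have hnd : ‖F.derivative.aeval (i : ℤ_[p])‖ = 1 := by
    apply hn1
    rw [hd, map_mul, map_pow, map_natCast, map_natCast, hia]
    refine mul_ne_zero ?_ (pow_ne_zero _ a.ne_zero)
    rw [Ne, ZMod.natCast_eq_zero_iff]
    intro h; have := Nat.le_of_dvd (by omega) h; omega
  have hev : F.aeval (i : ℤ_[p]) = (i : ℤ_[p]) ^ (p - 1) - 1 := by simp [hF]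
  obtain ⟨z, hz1, hz2, -⟩ := hensels_lemma (p := p) (R := ℤ_[p]) (F := F) (a := (i : ℤ_[p])) (by
    rw [hnd, one_pow, hz, hev, map_sub, map_pow, map_natCast, hia, map_one,
      ZMod.pow_card_sub_one_eq_one a.ne_zero, sub_self])
  refine ⟨z, ?_, ?_⟩
  · have : F.aeval z = z ^ (p - 1) - 1 := by simp [hF]
    rw [this] at hz1
    exact sub_eq_zero.1 hz1
  · rw [hnd, hz, map_sub, map_natCast, hia] at hz2
    exact sub_eq_zero.1 hz2

lemma rou_mem {p : ℕ} [Fact p.Prime] {A : Type} [Field A] (f : ℤ_[p] →+* A)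
    (hf : Function.Injective f) (y : A) (hy : y ^ (p - 1) = 1) : ∃ z, f z = y := by
  classical
  have hpr : p.Prime := Fact.out
  have hp1 : 0 < p - 1 := by have := hpr.two_le; omega
  choose z hz1 hz2 using fun a => teich (p := p) a
  have hinj : Function.Injective (fun a : (ZMod p)ˣ => f (z a)) := by
    intro a b hab
    have := hf hab
    apply Units.ext
    rw [← hz2 a, ← hz2 b, this]
  have hsub : Finset.univ.image (fun a : (ZMod p)ˣ => f (z a)) ⊆ nthRootsFinset (p - 1) (1 : A) := by
    intro b hb
    obtain ⟨a, -, rfl⟩ := Finset.mem_image.1 hb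
    rw [mem_nthRootsFinset hp1, ← map_pow, hz1, map_one]
  have heq := Finset.eq_of_subset_of_card_le hsub (by
    rw [Finset.card_image_of_injective _ hinj, Finset.card_univ, ZMod.card_units_eq_totient,
      Nat.totient_prime hpr]
    refine le_trans (Multiset.toFinset_card_le _) (card_nthRoots _ _))
  have : y ∈ nthRootsFinset (p - 1) (1 : A) := by rw [mem_nthRootsFinset hp1]; exact hy
  rw [← heq] at this
  obtain ⟨a, -, ha⟩ := Finset.mem_image.1 this
  exact ⟨z a, ha⟩

end rou
end S6

section

/-- (Theorem 2.6 iii)). Let `L/K` satisfy condition (ram) with parameter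
`n ≥ 1`, assume `G^1` is cyclic and `K` is unramified over `ℚ_p` (i.e. `p` is a
uniformizer of `K`), and let `χ` be a character of `G` of conductor `p^{n+1}`.
Write `χ = ωψ` where `ω` factors through the unique subgroup `Δ` of `G` of order `p−1`
(equivalently, `ω` is trivial on `G^1`) and `ψ` has order `p^n`.  For `α ∈ O_L` put
`α_ω := ∑_{ρ∈Δ} ω(ρ)·α^ρ`.  Then for any `α` in the maximal ideal `m_L` with
`v_L(α_ω) < p` (i.e. `α_ω ∉ m_L^p`), there exists `β ∈ O_L` such that
`v_π(⟨α|χ⟩) + v_π(⟨β|χ⁻¹⟩) = v_π(∑_{γ∈G} Tr_{L/K}(α^γ β)·χ(γ)) = n+1`. -/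
theorem statement6 {p : ℕ} [Fact p.Prime] (hp : Odd p)
    {A : Type} [Field A] (vd : PadicValData A p)
    (K L : Type) [Field K] [Field L]
    [Algebra ℚ_[p] K] [FiniteDimensional ℚ_[p] K]
    [Algebra K L] [FiniteDimensional K L] [IsGalois K L]
    (emb : L →+* A)
    (hab : ∀ σ τ : L ≃ₐ[K] L, σ * τ = τ * σ)
    (π : K) (hπ : IsUniformizer vd (emb.comp (algebraMap K L)) π)
    (hunram : IsUniformizer vd (emb.comp (algebraMap K L)) (p : K))
    (n : ℕ) (hn : 1 ≤ n) (hram : RamCond vd K L emb n)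
    (hcyc : ∃ g ∈ upperRamSet vd K L emb 1,
      ∀ h ∈ upperRamSet vd K L emb 1, ∃ k : ℕ, h = g ^ k)
    (Δ : Subgroup (L ≃ₐ[K] L)) (hΔ : Nat.card ↥Δ = p - 1)
    (hΔuniq : ∀ Δ' : Subgroup (L ≃ₐ[K] L), Nat.card ↥Δ' = p - 1 → Δ' = Δ)
    (χ ω ψ : (L ≃ₐ[K] L) →* A)
    (hχ : χ = ω * ψ)
    (hω : ∀ σ ∈ upperRamSet vd K L emb 1, ω σ = 1)
    (hψ : orderOf ψ = p ^ n)
    (hcond : ∃ τ ∈ upperRamSet vd K L emb (n : ℤ), χ τ ≠ 1)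
    (α : L) (hα : InMaxIdealPow vd emb 1 (emb α))
    (hαω : ¬ InMaxIdealPow vd emb p (∑ᶠ ρ : ↥Δ, ω (ρ : L ≃ₐ[K] L) * emb ((ρ : L ≃ₐ[K] L) α))) :
    ∃ β : L, 0 ≤ vd.v (emb β) ∧
      vd.v (localResolvent K L emb (⇑χ) α)
          + vd.v (localResolvent K L emb (fun γ => χ γ⁻¹) β)
        = (n + 1) • vd.v ((emb.comp (algebraMap K L)) π) ∧
      vd.v (∑ᶠ γ : L ≃ₐ[K] L,
          χ γ * (emb.comp (algebraMap K L)) (Algebra.trace K L (γ α * β)))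
        = (n + 1) • vd.v ((emb.comp (algebraMap K L)) π) := by
  classical
  have hpr : p.Prime := Fact.out
  have hp3 : 3 ≤ p := by
    have := hpr.two_le
    have h2 : p ≠ 2 := by rintro rfl; exact absurd hp (by decide)
    omega
  have hp2 : p ≠ 2 := by omega
  set v := S6.val vd with hv
  have hvp : v (p : A) = ((1 : ℚ) : WithTop ℚ) := S6.val_p vd
  have hint : ∀ k : K, k ≠ 0 → ∃ m : ℤ,
      v ((emb.comp (algebraMap K L)) k) = ((m : ℚ) : WithTop ℚ) :=
    fun k hk => S6.int_of_unram v hvp _ hunram.2.2 k hk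
  set ι : ℚ_[p] →+* A := (emb.comp (algebraMap K L)).comp (algebraMap ℚ_[p] K) with hι
  have hpad : ∀ x : ℚ_[p], x ≠ 0 → v (ι x) = ((x.valuation : ℚ) : WithTop ℚ) :=
    S6.padic_val hp2 v hvp ι (fun k hk => hint _ ((map_ne_zero _).2 hk))
  have hpnn : ∀ z : ℤ_[p], 0 ≤ v (ι z) :=
    S6.padic_nonneg hp2 v hvp ι (fun k hk => hint _ ((map_ne_zero _).2 hk))
  set v0 : AddValuation L (WithTop ℚ) := v.comap emb with hv0
  have hv0a : ∀ x, v0 x = v (emb x) := fun x => rfl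
  have hinv0 : ∀ (σ : L ≃ₐ[K] L) (x : L), v0 (σ x) = v0 x :=
    S6.gal_inv (p := p) v0 (fun x hx => hpad x hx)
  have hv0p : v0 (p : L) = ((1 : ℚ) : WithTop ℚ) := by rw [hv0a, map_natCast, hvp]
  obtain ⟨e, ϖ, he, hϖ0, hval⟩ := S6.exists_e (K := K) v0 hinv0 (fun k hk => hint k hk) hv0p
  obtain ⟨w, hw0⟩ := S6.exists_w v0 he hval
  have hw : ∀ (x : L) (m : ℤ),
      (w x = (m : WithTop ℤ) ↔ vd.v (emb x) = (((m : ℚ) / e : ℚ) : WithTop ℚ)) := hw0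
  have heq : (e : ℚ) ≠ 0 := by exact_mod_cast he.ne'
  have hϖ : w ϖ = ((1 : ℤ) : WithTop ℤ) := (hw0 _ _).2 hϖ0
  have hinv : ∀ (σ : L ≃ₐ[K] L) (x : L), w (σ x) = w x := by
    intro σ x
    by_cases hx : x = 0
    · simp [hx]
    obtain ⟨m, hm⟩ := S6.exists_eq w hx
    rw [hm, hw0, hinv0, ← hw0, hm]
  have hwK : ∀ (x : L) (m : ℤ), v (emb x) = ((m : ℚ) : WithTop ℚ) → w x = ((e * m : ℤ) : WithTop ℤ) := by
    intro x m hm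
    rw [hw0, hv0a, hm]; congr 1; push_cast; field_simp
  have hwp : w (p : L) = ((e : ℤ) : WithTop ℤ) := by
    have := hwK (p : L) 1 (by rw [map_natCast, hvp]; simp)
    simpa using this
  have hK : ∀ k : K, k ≠ 0 → ∃ m : ℤ, w (algebraMap K L k) = ((e * m : ℤ) : WithTop ℤ) := by
    intro k hk
    obtain ⟨m, hm⟩ := hint k hk
    exact ⟨m, hwK _ m hm⟩
  -- periodicity in the residue field
  set jK : ℤ_[p] →+* K := (algebraMap ℚ_[p] K).comp PadicInt.Coe.ringHom with hjK
  have hjKι : ∀ z, emb (algebraMap K L (jK z)) = ι z := fun z => rfl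
  have hjinj : Function.Injective ((algebraMap K L).comp jK) := by
    intro a b hab
    exact Subtype.ext ((algebraMap ℚ_[p] K).injective ((algebraMap K L).injective hab))
  have hj0 : ∀ z, ((0 : ℤ) : WithTop ℤ) ≤ w (algebraMap K L (jK z)) := by
    intro z
    rw [← S6.link_ge he hw]
    exact hpnn z
  have hp0 : (p : L) ≠ 0 := S6.ne_zero_of_eq w hwp
  have hper : ∀ x : L, ((0 : ℤ) : WithTop ℤ) ≤ w x →
      ∃ N, n ≤ N ∧ ((1 : ℤ) : WithTop ℤ) ≤ w (x ^ (p ^ N) - x) := by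
    intro x hx
    let _ : Algebra ℚ_[p] L := ((algebraMap K L).comp (algebraMap ℚ_[p] K)).toAlgebra
    have _ : IsScalarTower ℚ_[p] K L := IsScalarTower.of_algebraMap_eq' rfl
    have _ : FiniteDimensional ℚ_[p] L := FiniteDimensional.trans ℚ_[p] K L
    let _ : Algebra ℤ_[p] L := ((algebraMap K L).comp jK).toAlgebra
    have _ : IsScalarTower ℤ_[p] ℚ_[p] L := IsScalarTower.of_algebraMap_eq' rfl
    have h1 : IsAlgebraic ℚ_[p] x := Algebra.IsAlgebraic.isAlgebraic x
    have h2 : IsAlgebraic ℤ_[p] x := (IsFractionRing.isAlgebraic_iff ℤ_[p] ℚ_[p] L).2 h1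
    obtain ⟨f, hf0, hf⟩ := h2
    exact S6.exists_period w ((algebraMap K L).comp jK) hj0
      (by rw [hwp]; exact WithTop.coe_le_coe.2 (by omega)) hp0 x hx f hf0 hf n
  obtain ⟨g, hg, hgen⟩ := hcyc
  have S : S6.Gal p n K L w ϖ e g Δ :=
    S6.mkGal hp3 he hw hϖ hinv hn hram hab hwp hK hper g hg hgen Δ hΔ
  -- characters
  have hΔpow : ∀ ρ ∈ Δ, ρ ^ (p - 1) = 1 := by
    intro ρ hρ
    have := pow_card_eq_one' (x := (⟨ρ, hρ⟩ : Δ))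
    rw [hΔ] at this
    exact congrArg Subtype.val this
  have hcop : Nat.Coprime (p - 1) (p ^ n) :=
    ((S.core.prime.coprime_iff_not_dvd).2 S.not_dvd).symm.pow_right n
  have hψpow : ∀ σ, ψ σ ^ (p ^ n) = 1 := by
    intro σ
    have := pow_orderOf_eq_one ψ
    rw [hψ] at this
    have h2 := DFunLike.congr_fun this σ
    simpa using h2
  have hψΔ : ∀ ρ ∈ Δ, ψ ρ = 1 := by
    intro ρ hρ
    have h1 : ψ ρ ^ (p - 1) = 1 := by rw [← map_pow, hΔpow ρ hρ, map_one]
    have h2 := Nat.dvd_gcd (orderOf_dvd_of_pow_eq_one h1) (orderOf_dvd_of_pow_eq_one (hψpow ρ))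
    rw [Nat.Coprime.gcd_eq_one hcop, Nat.dvd_one, orderOf_eq_one_iff] at h2
    exact h2
  have hζ : IsPrimitiveRoot (ψ g) (p ^ n) := by
    refine ⟨hψpow g, fun l hl => ?_⟩
    rw [← hψ]
    apply orderOf_dvd_of_pow_eq_one
    ext σ
    obtain ⟨k, -, ρ, rfl⟩ := S.decomp σ
    rw [MonoidHom.pow_apply, map_mul, hψΔ ρ ρ.2, one_mul, map_pow, ← pow_mul, mul_comm, pow_mul, hl,
      one_pow, MonoidHom.one_apply]
  have hrou : ∀ ρ : Δ, ∃ z : ℤ_[p], emb (algebraMap K L (jK z)) = ω ρ := by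
    intro ρ
    refine S6.rou_mem (emb.comp ((algebraMap K L).comp jK)) (emb.injective.comp hjinj) (ω ρ) ?_
    rw [← map_pow, hΔpow ρ ρ.2, map_one]
  choose z hz using hrou
  set a : L := ∑ ρ : Δ, algebraMap K L (jK (z ρ)) * (ρ : L ≃ₐ[K] L) α with ha
  have hea : (∑ᶠ ρ : ↥Δ, ω (ρ : L ≃ₐ[K] L) * emb ((ρ : L ≃ₐ[K] L) α)) = emb a := by
    rw [finsum_eq_sum_of_fintype, ha, map_sum]
    refine Finset.sum_congr rfl (fun ρ _ => ?_)
    rw [map_mul, hz]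
  rw [hea, S6.link_pow he hw hϖ] at hαω
  rw [S6.link_pow he hw hϖ] at hα
  have hα1 : ((1 : ℤ) : WithTop ℤ) ≤ w α := by simpa using hα
  have ha0 : a ≠ 0 := by
    intro h; apply hαω; rw [h]; simp
  obtain ⟨a0, hwa⟩ := S6.exists_eq w ha0
  have h1 : 1 ≤ a0 := by
    have : ((1 : ℤ) : WithTop ℤ) ≤ w a := by
      rw [ha]
      refine w.map_le_sum (fun ρ _ => ?_)
      have := S6.ge_mul w (hj0 (z ρ)) (show ((1 : ℤ) : WithTop ℤ) ≤ w ((ρ : L ≃ₐ[K] L) α) by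
        rw [hinv]; exact hα1)
      simpa using this
    rw [hwa] at this
    exact WithTop.coe_le_coe.1 this
  have h2 : a0 < p := by
    rw [hwa] at hαω
    by_contra hcon
    exact hαω (WithTop.coe_le_coe.2 (by omega))
  obtain ⟨β, hβ0, hβ⟩ := S.final emb v hvp hint χ ω ψ hχ (hω g hg) hψΔ hζ α (fun ρ => jK (z ρ))
    (fun ρ => (hz ρ).symm) (a0 := a0) (by convert hwa) h1 h2
  have hvπ : (n + 1) • vd.v ((emb.comp (algebraMap K L)) π) = ((n + 1 : ℚ) : WithTop ℚ) := by
    have e1 : vd.v ((emb.comp (algebraMap K L)) π) = ((1 : ℚ) : WithTop ℚ) := by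
      have h3 := le_antisymm (hπ.2.2 _ hunram.2.1) (hunram.2.2 _ hπ.2.1)
      rw [h3, map_natCast]; exact hvp
    rw [e1, ← WithTop.coe_nsmul]; congr 1; simp
  refine ⟨β, (S6.link_ge he hw β).2 hβ0, ?_, ?_⟩
  · rw [hvπ, ← hβ, S6.res_mul emb χ α β, v.map_mul]
    unfold localResolvent
    rw [finsum_eq_sum_of_fintype, finsum_eq_sum_of_fintype]
    rfl
  · rw [hvπ, ← hβ, finsum_eq_sum_of_fintype]
    rfl

end
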